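/- arXiv:1706.03342 — 5 statements merged into one kernel-verified Lean document; each statement's English description precedes it below -/
import Mathlib

section
/- Let C > 0, let ρ₁ ≥ ρ₂ ≥ 0 satisfy (1+ρ₁)(1+ρ₂) = 2^C, let 0 ≤ R ≤ C, and let t ∈ [0,1]. If 2·log₂(1 + ρ₂ + t·(ρ₁ − ρ₂)) < R, then 2·log₂(1 + ρ₂ + (1−t)·(ρ₁ − ρ₂)) > R. -/
/-- for a 2×2 unitarily precoded channel with squared singular
values `ρ₁ ≥ ρ₂ ≥ 0`, `(1+ρ₁)(1+ρ₂) = 2^C`, `0 ≤ R ≤ C` and `t ∈ [0,1]`: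
if `2·log₂(1+ρ₂+t(ρ₁−ρ₂)) < R` then `2·log₂(1+ρ₂+(1−t)(ρ₁−ρ₂)) > R`. -/
theorem outage_events_disjoint (C ρ₁ ρ₂ R t : ℝ) (hC : 0 < C)
    (hρ₂ : 0 ≤ ρ₂) (hρ : ρ₂ ≤ ρ₁)
    (hprod : (1 + ρ₁) * (1 + ρ₂) = (2 : ℝ) ^ C)
    (hR0 : 0 ≤ R) (hRC : R ≤ C) (ht : t ∈ Set.Icc (0 : ℝ) 1)
    (h : 2 * Real.logb 2 (1 + ρ₂ + t * (ρ₁ - ρ₂)) < R) :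
    2 * Real.logb 2 (1 + ρ₂ + (1 - t) * (ρ₁ - ρ₂)) > R := by
  obtain ⟨h0, h1⟩ := ht
  have hd : 0 ≤ ρ₁ - ρ₂ := by linarith
  have ha : 0 < 1 + ρ₂ + t * (ρ₁ - ρ₂) := by
    have := mul_nonneg h0 hd
    linarith
  have hb : 0 < 1 + ρ₂ + (1 - t) * (ρ₁ - ρ₂) := by
    have := mul_nonneg (sub_nonneg.mpr h1) hd
    linarith
  have hprod' : (2 : ℝ) ^ C ≤
      (1 + ρ₂ + t * (ρ₁ - ρ₂)) * (1 + ρ₂ + (1 - t) * (ρ₁ - ρ₂)) := by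
    rw [← hprod]
    have := mul_nonneg (mul_nonneg h0 (sub_nonneg.mpr h1)) (mul_nonneg hd hd)
    linarith
  have hlog := (Real.le_logb_iff_rpow_le (by norm_num : (1 : ℝ) < 2) (mul_pos ha hb)).mpr hprod'
  rw [Real.logb_mul ha.ne' hb.ne'] at hlog
  linarith
end

section
/- Let C > 0 and let h = (h₁, h₂) be uniformly distributed on the sphere {h ∈ ℂ² : |h₁|² + |h₂|² = 2^C − 1}. Define C_sym = min{ 2·log₂(1 + |h₁|²), 2·log₂(1 + |h₂|²), C }. Then for every R with 0 ≤ R ≤ C: P(C_sym < R) = 2·(2^{R/2} − 1)/(2^C − 1). -/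
open MeasureTheory

noncomputable instance {n : ℕ} : MeasurableSpace (EuclideanSpace ℂ (Fin n)) :=
  borel _

abbrev E2 : Type := EuclideanSpace ℂ (Fin 2)

instance : BorelSpace E2 := ⟨rfl⟩

/-- The pair-of-coordinates identification. -/
noncomputable def toE2 : (ℂ × ℂ) ≃L[ℂ] E2 :=
  ((PiLp.continuousLinearEquiv 2 ℂ (fun _ : Fin 2 => ℂ)).trans
    (ContinuousLinearEquiv.finTwoArrow ℂ ℂ)).symm

lemma toE2_zero (p : ℂ × ℂ) : (toE2 p) 0 = p.1 := rfl
lemma toE2_one (p : ℂ × ℂ) : (toE2 p) 1 = p.2 := rfl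

/-- Lebesgue measure on `ℂ²`. -/
noncomputable def nuE2 : Measure E2 := Measure.map toE2 (volume : Measure (ℂ × ℂ))

instance : (volume : Measure (ℂ × ℂ)).IsAddHaarMeasure :=
  inferInstanceAs (((volume : Measure ℂ).prod (volume : Measure ℂ)).IsAddHaarMeasure)

instance : nuE2.IsAddHaarMeasure :=
  ContinuousLinearEquiv.isAddHaarMeasure_map toE2 (volume : Measure (ℂ × ℂ))

lemma normSq_E2 (x : E2) : ‖x‖ ^ 2 = ‖x 0‖ ^ 2 + ‖x 1‖ ^ 2 := by
  rw [EuclideanSpace.norm_sq_eq, Fin.sum_univ_two]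

lemma nuE2_map (e : E2 ≃ₗᵢ[ℂ] E2) : Measure.map e nuE2 = nuE2 := by
  have h1 : (Measure.map e nuE2).IsAddHaarMeasure :=
    ContinuousLinearEquiv.isAddHaarMeasure_map e.toContinuousLinearEquiv nuE2
  have h2 := Measure.isAddLeftInvariant_eq_smul (Measure.map e nuE2) nuE2
  have h3 : Measure.map e nuE2 (Metric.ball 0 1) = nuE2 (Metric.ball 0 1) := by
    rw [Measure.map_apply e.continuous.measurable measurableSet_ball]
    congr 1
    ext x
    simp
  rw [h2] at h3 ⊢
  rw [Measure.smul_apply] at h3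
  have hpos : nuE2 (Metric.ball 0 1) ≠ 0 := (Metric.measure_ball_pos nuE2 0 one_pos).ne'
  have hfin : nuE2 (Metric.ball 0 1) ≠ ⊤ := measure_ball_lt_top.ne
  generalize Measure.addHaarScalarFactor (Measure.map e nuE2) nuE2 = c at h3 ⊢
  have : (c : ENNReal) = 1 := by
    have h4 : (c : ENNReal) * nuE2 (Metric.ball 0 1) = 1 * nuE2 (Metric.ball 0 1) := by
      rw [one_mul]; exact h3
    exact (ENNReal.mul_left_inj hpos hfin).1 h4
  have : c = 1 := by exact_mod_cast this
  rw [this, one_smul]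

/-- The Gaussian weight. -/
noncomputable def wE2 (x : E2) : ENNReal := ENNReal.ofReal (Real.exp (-‖x‖ ^ 2))

lemma wE2_meas : Measurable wE2 := by
  unfold wE2
  have : Continuous fun x : E2 => Real.exp (-‖x‖ ^ 2) := by fun_prop
  exact this.measurable.ennreal_ofReal

noncomputable def gaE2 : Measure E2 := nuE2.withDensity wE2

lemma gaE2_preimage (e : E2 ≃ₗᵢ[ℂ] E2) {A : Set E2} (hA : MeasurableSet A) :
    gaE2 (e ⁻¹' A) = gaE2 A := by
  have he : Measurable e := e.continuous.measurable
  have hp : MeasurePreserving e nuE2 nuE2 := ⟨he, nuE2_map e⟩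
  unfold gaE2
  rw [withDensity_apply _ (he hA), withDensity_apply _ hA,
    ← hp.setLIntegral_comp_preimage hA wE2_meas]
  simp [wE2]

lemma exists_unitary (x : E2) (hx : x ≠ 0) :
    ∃ e : E2 ≃ₗᵢ[ℂ] E2, ∀ y, ‖inner ℂ x y‖ = ‖x‖ * ‖(e y) 0‖ := by
  have hn : ‖x‖ ≠ 0 := norm_ne_zero_iff.2 hx
  have ho : Orthonormal ℂ (({0} : Set (Fin 2)).domRestrict
      (fun _ : Fin 2 => ((‖x‖ : ℂ)⁻¹) • x)) := by
    constructor
    · intro i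
      simp [norm_smul, hn]
    · intro i j hij
      exact absurd (Subsingleton.elim i j) hij
  obtain ⟨b, hb⟩ := ho.exists_orthonormalBasis_extension_of_card_eq (by simp)
  refine ⟨b.repr, fun y => ?_⟩
  rw [b.repr_apply_apply, hb 0 rfl, inner_smul_left, norm_mul]
  simp
  field_simp

lemma map_normSq : Measure.map (fun z : ℂ => ‖z‖ ^ 2) volume =
    ENNReal.ofReal Real.pi • (volume : Measure ℝ).restrict (Set.Ioi 0) := by
  have hm : Measurable (fun z : ℂ => ‖z‖ ^ 2) := by fun_prop
  have key : ∀ a : ℝ, Measure.map (fun z : ℂ => ‖z‖ ^ 2) volume (Set.Iio a) =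
      ENNReal.ofReal Real.pi * ENNReal.ofReal a := by
    intro a
    rw [Measure.map_apply hm measurableSet_Iio]
    rcases le_or_gt a 0 with ha | ha
    · rw [ENNReal.ofReal_of_nonpos ha, mul_zero]
      convert measure_empty (μ := (volume : Measure ℂ))
      ext z
      simp only [Set.mem_preimage, Set.mem_Iio, Set.mem_empty_iff_false, iff_false, not_lt]
      exact ha.trans (by positivity)
    · have : (fun z : ℂ => ‖z‖ ^ 2) ⁻¹' Set.Iio a = Metric.ball 0 (Real.sqrt a) := by
        ext z
        simp [Real.lt_sqrt]
      rw [this, Complex.volume_ball, ← ENNReal.ofReal_pow (Real.sqrt_nonneg _),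
        Real.sq_sqrt ha.le, mul_comm]
      congr 1
      rw [ENNReal.ofReal]
      congr 1
      ext
      simp [Real.pi_pos.le]
  refine Measure.ext_of_generateFrom_of_iUnion _ (fun n : ℕ => Set.Iio (n : ℝ))
    (borel_eq_generateFrom_Iio ℝ ▸ BorelSpace.measurable_eq) isPiSystem_Iio ?_ ?_ ?_ ?_
  · ext x
    simpa using exists_nat_gt x
  · exact fun n => ⟨_, rfl⟩
  · intro n
    rw [key]
    exact ENNReal.mul_ne_top ENNReal.ofReal_ne_top ENNReal.ofReal_ne_top
  · rintro _ ⟨a, rfl⟩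
    rw [key, Measure.smul_apply, Measure.restrict_apply measurableSet_Iio, Set.Iio_inter_Ioi]
    simp

lemma lintegral_normSq {f : ℝ → ENNReal} (hf : Measurable f) :
    ∫⁻ z : ℂ, f (‖z‖ ^ 2) = ENNReal.ofReal Real.pi * ∫⁻ u in Set.Ioi 0, f u := by
  have hm : Measurable (fun z : ℂ => ‖z‖ ^ 2) := by fun_prop
  rw [← lintegral_map hf hm, map_normSq, lintegral_smul_measure, smul_eq_mul]

lemma lint_exp {a : ℝ} (ha : 0 < a) (c : ℝ) :
    ∫⁻ u in Set.Ioi c, ENNReal.ofReal (Real.exp (-a * u)) =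
      ENNReal.ofReal (Real.exp (-a * c) / a) := by
  rw [← ofReal_integral_eq_lintegral_ofReal (integrableOn_exp_mul_Ioi (by linarith) c)
    (Filter.Eventually.of_forall fun x => (Real.exp_pos _).le),
    integral_exp_mul_Ioi (by linarith)]
  congr 1
  rw [neg_div_neg_eq]

/-- Gaussian mass of the cone. -/
lemma gaE2_cone {k : ℝ} (hk : 0 ≤ k) :
    gaE2 {x : E2 | k * ‖x 0‖ ^ 2 < ‖x 1‖ ^ 2} =
      ENNReal.ofReal Real.pi * (ENNReal.ofReal Real.pi * ENNReal.ofReal (1 / (1 + k))) := by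
  have hc : ∀ i : Fin 2, Continuous fun x : E2 => x i := fun i => by fun_prop
  have hA : MeasurableSet {x : E2 | k * ‖x 0‖ ^ 2 < ‖x 1‖ ^ 2} :=
    (isOpen_lt (by fun_prop) (by fun_prop)).measurableSet
  unfold gaE2
  rw [withDensity_apply _ hA, ← lintegral_indicator hA, nuE2,
    lintegral_map (wE2_meas.indicator hA) toE2.continuous.measurable,
    Measure.volume_eq_prod, lintegral_prod
      (fun a => ({x : E2 | k * ‖x 0‖ ^ 2 < ‖x 1‖ ^ 2}).indicator wE2 (toE2 a))
      ((wE2_meas.indicator hA).comp toE2.continuous.measurable).aemeasurable]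
  have h1 : ∀ a b : ℂ, ({x : E2 | k * ‖x 0‖ ^ 2 < ‖x 1‖ ^ 2}).indicator wE2 (toE2 (a, b)) =
      ENNReal.ofReal (Real.exp (-1 * ‖a‖ ^ 2)) * (Set.Ioi (k * ‖a‖ ^ 2)).indicator
        (fun v => ENNReal.ofReal (Real.exp (-1 * v))) (‖b‖ ^ 2) := by
    intro a b
    by_cases h : k * ‖a‖ ^ 2 < ‖b‖ ^ 2
    · rw [Set.indicator_of_mem (by exact h), Set.indicator_of_mem (by exact h), wE2, normSq_E2,
        toE2_zero, toE2_one, ← ENNReal.ofReal_mul (Real.exp_pos _).le, ← Real.exp_add]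
      congr 2
      ring
    · rw [Set.indicator_of_notMem (by exact h), Set.indicator_of_notMem (by exact h), mul_zero]
  have h2 : ∀ a : ℂ, ∫⁻ b : ℂ, ({x : E2 | k * ‖x 0‖ ^ 2 < ‖x 1‖ ^ 2}).indicator wE2 (toE2 (a, b))
      = ENNReal.ofReal Real.pi * ENNReal.ofReal (Real.exp (-(1 + k) * ‖a‖ ^ 2)) := by
    intro a
    have hme : Measurable fun v : ℝ => ENNReal.ofReal (Real.exp (-1 * v)) := by fun_prop
    simp_rw [h1]
    rw [lintegral_const_mul' _ _ ENNReal.ofReal_ne_top,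
      lintegral_normSq (hme.indicator measurableSet_Ioi),
      setLIntegral_indicator measurableSet_Ioi, Set.Ioi_inter_Ioi, sup_of_le_left (by positivity),
      lint_exp one_pos, mul_left_comm, ← ENNReal.ofReal_mul (Real.exp_pos _).le, div_one,
      ← Real.exp_add]
    congr 3
    ring
  simp_rw [h2]
  rw [lintegral_const_mul' _ _ ENNReal.ofReal_ne_top,
    lintegral_normSq (f := fun u => ENNReal.ofReal (Real.exp (-(1 + k) * u))) (by fun_prop),
    lint_exp (by linarith)]
  simp

lemma nuE2_one_zero : nuE2 {x : E2 | x 1 = 0} = 0 := by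
  have hA : MeasurableSet {x : E2 | x 1 = 0} :=
    (isClosed_eq (by fun_prop) (by fun_prop)).measurableSet
  rw [nuE2, Measure.map_apply toE2.continuous.measurable hA]
  have : toE2 ⁻¹' {x : E2 | x 1 = 0} = Set.univ ×ˢ {0} := by
    ext p
    simp [toE2_one]
  rw [this, Measure.volume_eq_prod, Measure.prod_prod]
  simp

lemma gaE2_one_zero : gaE2 {x : E2 | x 1 = 0} = 0 :=
  withDensity_absolutelyContinuous _ _ nuE2_one_zero

lemma gaE2_univ : gaE2 Set.univ =
    ENNReal.ofReal Real.pi * ENNReal.ofReal Real.pi := by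
  have h := gaE2_cone le_rfl
  rw [add_zero, div_one, ENNReal.ofReal_one, mul_one] at h
  rw [← h]
  refine measure_congr ?_
  have : ∀ᵐ x ∂gaE2, ¬ (x 1 = 0) := by
    rw [ae_iff]; simpa using gaE2_one_zero
  filter_upwards [this] with x hx
  apply propext
  change True ↔ 0 * ‖x 0‖ ^ 2 < ‖x 1‖ ^ 2
  simp [hx]

instance : IsFiniteMeasure gaE2 := ⟨by
  rw [gaE2_univ]; exact ENNReal.mul_lt_top ENNReal.ofReal_lt_top ENNReal.ofReal_lt_top⟩

lemma law_normSq (S r : ℝ) (hS : 0 < S) (hr : 0 ≤ r) (hrS : r ≤ S)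
    (μ : Measure E2) [IsProbabilityMeasure μ]
    (hsphere : ∀ᵐ h ∂μ, ‖h‖ ^ 2 = S)
    (hinv : ∀ e : E2 ≃ₗᵢ[ℂ] E2, Measure.map e μ = μ) :
    μ {h : E2 | ‖h 0‖ ^ 2 < r} = ENNReal.ofReal (r / S) := by
  rcases hr.eq_or_lt with rfl | hr
  · have : {h : E2 | ‖h 0‖ ^ 2 < 0} = ∅ := by
      ext x
      simp only [Set.mem_ofPred_eq, Set.mem_empty_iff_false, iff_false, not_lt]
      positivity
    rw [this]; simp
  let T : Set (E2 × E2) := {p | ‖inner ℂ p.1 p.2‖ ^ 2 < r * ‖p.1‖ ^ 2}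
  have hT : MeasurableSet T := (isOpen_lt (by fun_prop) (by fun_prop)).measurableSet
  have hM : MeasurableSet {h : E2 | ‖h 0‖ ^ 2 < r} :=
    (isOpen_lt (by fun_prop) (by fun_prop)).measurableSet
  have hk : 0 ≤ (S - r) / r := div_nonneg (by linarith) hr.le
  have hM2 : MeasurableSet {x : E2 | (S - r) / r * ‖x 0‖ ^ 2 < ‖x 1‖ ^ 2} :=
    (isOpen_lt (by fun_prop) (by fun_prop)).measurableSet
  have e1 : gaE2.prod μ T = μ {h : E2 | ‖h 0‖ ^ 2 < r} * gaE2 Set.univ := by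
    rw [Measure.prod_apply hT, ← lintegral_const]
    refine lintegral_congr_ae ?_
    have : ∀ᵐ x ∂gaE2, ¬ (x 1 = 0) := by
      rw [ae_iff]; simpa using gaE2_one_zero
    filter_upwards [this] with x hx
    have hx0 : x ≠ 0 := by rintro rfl; exact hx rfl
    obtain ⟨e, he⟩ := exists_unitary x hx0
    have hn : 0 < ‖x‖ ^ 2 := by positivity
    conv_rhs => rw [← hinv e, Measure.map_apply e.continuous.measurable hM]
    congr 1
    ext y
    simp only [T, Set.mem_preimage, Set.mem_ofPred_eq]
    rw [he, mul_pow, mul_comm]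
    exact mul_lt_mul_iff_left₀ hn
  have e2 : gaE2.prod μ T = gaE2 {x : E2 | (S - r) / r * ‖x 0‖ ^ 2 < ‖x 1‖ ^ 2} := by
    rw [Measure.prod_apply_symm hT]
    have : ∀ᵐ h ∂μ, gaE2 ((fun x => (x, h)) ⁻¹' T) =
        gaE2 {x : E2 | (S - r) / r * ‖x 0‖ ^ 2 < ‖x 1‖ ^ 2} := by
      filter_upwards [hsphere] with h hh
      have hh0 : h ≠ 0 := by
        rintro rfl
        simp at hh
        exact hS.ne hh
      obtain ⟨e, he⟩ := exists_unitary h hh0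
      rw [← gaE2_preimage e hM2]
      congr 1
      ext x
      simp only [T, Set.mem_preimage, Set.mem_ofPred_eq]
      rw [norm_inner_symm, he, mul_pow, hh, ← e.norm_map x, normSq_E2, div_mul_eq_mul_div,
        div_lt_iff₀ hr]
      constructor <;> intro h <;> linarith
    rw [lintegral_congr_ae this]
    simp
  rw [e1, gaE2_univ, gaE2_cone hk, mul_comm,
    ← mul_assoc (ENNReal.ofReal Real.pi) (ENNReal.ofReal Real.pi) (ENNReal.ofReal _)] at e2
  have hpi : ENNReal.ofReal Real.pi ≠ 0 := by simp [Real.pi_pos]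
  rw [ENNReal.mul_right_inj (mul_ne_zero hpi hpi)
    (ENNReal.mul_ne_top ENNReal.ofReal_ne_top ENNReal.ofReal_ne_top)] at e2
  rw [e2]
  have h1 : 1 + (S - r) / r = S / r := by
    field_simp
    ring
  rw [h1, one_div_div]

lemma swap_unitary : ∃ e : E2 ≃ₗᵢ[ℂ] E2, ∀ y, (e y) 0 = y 1 :=
  ⟨LinearIsometryEquiv.piLpCongrLeft 2 ℂ ℂ (Equiv.swap (0 : Fin 2) 1), fun y => by simp [LinearIsometryEquiv.piLpCongrLeft_apply]⟩

/-- for `h = (h₁,h₂)` uniformly distributed on the complex sphere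
`{h : |h₁|² + |h₂|² = 2^C − 1}` (i.e. `μ` is a probability measure carried by the
sphere and invariant under every unitary transformation) and `0 ≤ R ≤ C`, the
symmetric-rate capacity `C_sym = min{2·log₂(1+|h₁|²), 2·log₂(1+|h₂|²), C}`
satisfies `P(C_sym < R) = 2·(2^{R/2} − 1)/(2^C − 1)`. -/
theorem two_user_MAC_sym_capacity_cdf (C R : ℝ) (hC : 0 < C) (hR0 : 0 ≤ R)
    (hRC : R ≤ C) (μ : Measure (EuclideanSpace ℂ (Fin 2))) [IsProbabilityMeasure μ]
    (hsphere : μ {h : EuclideanSpace ℂ (Fin 2) |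
        ‖h 0‖ ^ 2 + ‖h 1‖ ^ 2 = (2 : ℝ) ^ C - 1} = 1)
    (hinv : ∀ e : EuclideanSpace ℂ (Fin 2) ≃ₗᵢ[ℂ] EuclideanSpace ℂ (Fin 2),
      Measure.map e μ = μ) :
    (μ {h : EuclideanSpace ℂ (Fin 2) |
        min (min (2 * Real.logb 2 (1 + ‖h 0‖ ^ 2))
            (2 * Real.logb 2 (1 + ‖h 1‖ ^ 2))) C < R}).toReal =
      2 * ((2 : ℝ) ^ (R / 2) - 1) / ((2 : ℝ) ^ C - 1) := by
  have hinv' : ∀ e : E2 ≃ₗᵢ[ℂ] E2, Measure.map e μ = μ := hinv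
  set S : ℝ := (2 : ℝ) ^ C - 1 with hSdef
  set r : ℝ := (2 : ℝ) ^ (R / 2) - 1 with hrdef
  have hS : 0 < S := by
    have := Real.one_lt_rpow (x := 2) (by norm_num) hC
    linarith
  have hr : 0 ≤ r := by
    have := Real.one_le_rpow (x := 2) (z := R / 2) (by norm_num) (by linarith)
    linarith
  have h2rS : 2 * r ≤ S := by
    have h1 : (2 : ℝ) ^ (R / 2) ≤ (2 : ℝ) ^ (C / 2) :=
      Real.rpow_le_rpow_of_exponent_le (by norm_num) (by linarith)
    have h2 : (2 : ℝ) ^ C = (2 : ℝ) ^ (C / 2) * (2 : ℝ) ^ (C / 2) := by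
      rw [← Real.rpow_add (by norm_num)]; congr 1; ring
    have : S = (2 : ℝ) ^ C - 1 := rfl
    nlinarith [sq_nonneg ((2 : ℝ) ^ (C / 2) - 1)]
  have hsm : MeasurableSet {h : E2 | ‖h 0‖ ^ 2 + ‖h 1‖ ^ 2 = S} :=
    (isClosed_eq (by fun_prop) (by fun_prop)).measurableSet
  have hae : ∀ᵐ h ∂μ, ‖h‖ ^ 2 = S := by
    have := (prob_compl_eq_zero_iff hsm).2 hsphere
    rw [ae_iff]
    convert this using 2
    ext x
    simp [normSq_E2 x]
  have hM : MeasurableSet {h : E2 | ‖h 0‖ ^ 2 < r} :=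
    (isOpen_lt (by fun_prop) (by fun_prop)).measurableSet
  have hM1 : MeasurableSet {h : E2 | ‖h 1‖ ^ 2 < r} :=
    (isOpen_lt (by fun_prop) (by fun_prop)).measurableSet
  have p0 := law_normSq S r hS hr (by linarith) μ hae hinv'
  have p1 : μ {h : E2 | ‖h 1‖ ^ 2 < r} = ENNReal.ofReal (r / S) := by
    obtain ⟨e, he⟩ := swap_unitary
    rw [← p0]
    conv_rhs => rw [← hinv' e, Measure.map_apply e.continuous.measurable hM]
    congr 1
    ext y
    simp [he]
  have hlog : ∀ z : ℂ, 2 * Real.logb 2 (1 + ‖z‖ ^ 2) < R ↔ ‖z‖ ^ 2 < r := by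
    intro z
    have : 2 * Real.logb 2 (1 + ‖z‖ ^ 2) < R ↔ Real.logb 2 (1 + ‖z‖ ^ 2) < R / 2 := by
      constructor <;> intro h <;> linarith
    rw [this, Real.logb_lt_iff_lt_rpow (by norm_num) (by positivity)]
    constructor <;> intro h <;> linarith
  have hset : {h : E2 | min (min (2 * Real.logb 2 (1 + ‖h 0‖ ^ 2))
      (2 * Real.logb 2 (1 + ‖h 1‖ ^ 2))) C < R} =
      {h : E2 | ‖h 0‖ ^ 2 < r} ∪ {h : E2 | ‖h 1‖ ^ 2 < r} := by
    ext x
    simp only [Set.mem_ofPred_eq, Set.mem_union, min_lt_iff, hlog, not_lt.2 hRC, or_false]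
  have hdis : AEDisjoint μ {h : E2 | ‖h 0‖ ^ 2 < r} {h : E2 | ‖h 1‖ ^ 2 < r} := by
    refine measure_mono_null ?_ (ae_iff.1 hae)
    rintro x ⟨h0, h1⟩
    simp only [Set.mem_ofPred_eq] at h0 h1 ⊢
    rw [normSq_E2]
    linarith
  have hd : 0 ≤ r / S := div_nonneg hr hS.le
  rw [hset, measure_union₀ hM1.nullMeasurableSet hdis, p0, p1, ← ENNReal.ofReal_add hd hd,
    ENNReal.toReal_ofReal (by linarith)]
  ring
end

section
/- Let N ≥ 2, let μ be the Haar probability measure on the unitary group U(N) of N×N complex unitary matrices, and let 1 ≤ k ≤ N−1. Then for every x ∈ [0,1]: μ{U : Σ_{i=1}^{k} |U_{1,i}|² ≤ x} = B(x; k, N−k)/B(1; k, N−k), where B(x; a, b) = ∫₀ˣ u^{a−1}(1−u)^{b−1} du is the incomplete beta function. -/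
open MeasureTheory Matrix

noncomputable instance {n : ℕ} : MeasurableSpace (Matrix.unitaryGroup (Fin n) ℂ) :=
  borel _

open Set Module
open scoped ENNReal

/-- Polar coordinates for the lower Lebesgue integral of a radial function. -/
lemma lintegral_radial {E : Type*} [NormedAddCommGroup E] [NormedSpace ℝ E]
    [FiniteDimensional ℝ E] [Nontrivial E] [MeasurableSpace E] [BorelSpace E]
    (μ : Measure E) [μ.IsAddHaarMeasure] (f : ℝ → ℝ≥0∞) (hf : Measurable f) :
    ∫⁻ x, f ‖x‖ ∂μ = μ.toSphere univ *
      ∫⁻ y in Ioi (0 : ℝ), ENNReal.ofReal (y ^ (finrank ℝ E - 1)) * f y := by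
  calc
    ∫⁻ x, f (‖x‖) ∂μ = ∫⁻ x : ({(0)}ᶜ : Set E), f (‖x.1‖) ∂(μ.comap (↑)) := by
      rw [lintegral_subtype_comap (measurableSet_singleton _).compl fun x ↦ f (‖x‖),
        restrict_compl_singleton]
    _ = ∫⁻ x, f x.2 ∂μ.toSphere.prod (.volumeIoiPow (finrank ℝ E - 1)) := by
      simpa using μ.measurePreserving_homeomorphUnitSphereProd.lintegral_comp_emb
        (Homeomorph.measurableEmbedding _) (f ∘ Subtype.val ∘ Prod.snd)
    _ = μ.toSphere univ * ∫⁻ x : Ioi (0 : ℝ), f x ∂.volumeIoiPow (finrank ℝ E - 1) := by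
      rw [lintegral_prod _ (by fun_prop)]
      simp [mul_comm]
    _ = _ := by
      congr 1
      simp only [Measure.volumeIoiPow]
      rw [lintegral_withDensity_eq_lintegral_mul _ (by fun_prop) (by fun_prop)]
      exact lintegral_subtype_comap measurableSet_Ioi
        fun a ↦ ENNReal.ofReal (a ^ (finrank ℝ E - 1)) * f a

/-- The law of `∑ ‖z i‖ ^ 2` under Lebesgue measure on `ℂ^ι`. -/
lemma lintegral_sq_law (ι : Type*) [Fintype ι] [Nonempty ι] :
    ∃ C : ℝ≥0∞, C ≠ 0 ∧ C ≠ ⊤ ∧ ∀ h : ℝ → ℝ≥0∞, Measurable h →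
      ∫⁻ z : ι → ℂ, h (∑ i, ‖z i‖ ^ 2) =
        C * ∫⁻ t in Ioi (0 : ℝ), ENNReal.ofReal (t ^ (Fintype.card ι - 1)) * h t := by
  let L : (ι → ℂ) ≃L[ℂ] EuclideanSpace ℂ ι := (PiLp.continuousLinearEquiv 2 ℂ (fun _ : ι => ℂ)).symm
  let ν : Measure (EuclideanSpace ℂ ι) := Measure.map L volume
  have : ν.IsAddHaarMeasure := L.isAddHaarMeasure_map volume
  have hd : finrank ℝ (EuclideanSpace ℂ ι) = 2 * Fintype.card ι := by
    rw [← finrank_mul_finrank ℝ ℂ (EuclideanSpace ℂ ι)]; simp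
  have hc : 0 < Fintype.card ι := Fintype.card_pos
  refine ⟨ν.toSphere univ * 2⁻¹, ?_, ?_, fun h hh => ?_⟩
  · simp [-Measure.toSphere_apply_univ]
  · exact ENNReal.mul_ne_top (measure_ne_top _ _) (by simp)
  have h1 : ∫⁻ z : ι → ℂ, h (∑ i, ‖z i‖ ^ 2) = ∫⁻ y, h (‖y‖ ^ 2) ∂ν := by
    rw [lintegral_map (by fun_prop) L.continuous.measurable]
    refine lintegral_congr fun z => ?_
    rw [EuclideanSpace.norm_sq_eq]
    rfl
  rw [h1, lintegral_radial ν (fun y => h (y ^ 2)) (by fun_prop), mul_assoc]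
  congr 1
  have him : (fun r : ℝ => r ^ 2) '' Ioi 0 = Ioi 0 := by
    ext t
    constructor
    · rintro ⟨r, hr, rfl⟩
      exact pow_pos (mem_Ioi.1 hr) 2
    · intro ht
      exact ⟨√t, Real.sqrt_pos.2 ht, Real.sq_sqrt (le_of_lt ht)⟩
  have h2 := lintegral_image_eq_lintegral_abs_deriv_mul (s := Ioi (0 : ℝ)) (f := fun r => r ^ 2)
    (f' := fun r => 2 * r) measurableSet_Ioi
    (fun r _ => by simpa using (hasDerivAt_pow 2 r).hasDerivWithinAt)
    (fun a ha b hb hab => (pow_left_inj₀ (le_of_lt ha) (le_of_lt hb) two_ne_zero).1 hab)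
    (fun t => ENNReal.ofReal (t ^ (Fintype.card ι - 1)) * h t)
  rw [him] at h2
  rw [h2, ← lintegral_const_mul _ (by fun_prop)]
  refine setLIntegral_congr_fun measurableSet_Ioi fun r hr => ?_
  have hr : 0 < r := hr
  change _ = 2⁻¹ * _
  rw [← mul_assoc, ← mul_assoc, hd, abs_of_pos (by positivity), ENNReal.ofReal_mul (by norm_num),
    ← mul_assoc]
  simp only [ENNReal.ofReal_ofNat]
  rw [ENNReal.inv_mul_cancel (by simp) (by simp), one_mul, ← ENNReal.ofReal_mul hr.le, ← pow_mul,
    ← pow_succ']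
  congr 4
  omega

lemma beta_conv (a b : ℕ) (x : ℝ) (hx : x ∈ Icc (0 : ℝ) 1) (G : ℝ → ℝ≥0∞) (hG : Measurable G) :
    ∫⁻ p in Ioi (0 : ℝ), ENNReal.ofReal (p ^ a) * ∫⁻ q in Ioi (0 : ℝ), ENNReal.ofReal (q ^ b) *
      (if p ≤ x * (p + q) then G (p + q) else 0) =
    (∫⁻ t in Ioi (0 : ℝ), ENNReal.ofReal (t ^ (a + b + 1)) * G t) *
      ∫⁻ u in Ioc 0 x, ENNReal.ofReal (u ^ a * (1 - u) ^ b) := by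
  let H : ℝ → ℝ → ℝ≥0∞ := fun p t => if 0 < p ∧ p ≤ t ∧ p ≤ x * t then
    ENNReal.ofReal (p ^ a) * (ENNReal.ofReal ((t - p) ^ b) * G t) else 0
  have hH : Measurable (Function.uncurry H) := by
    refine Measurable.ite ?_ (by fun_prop) measurable_const
    refine (measurableSet_lt measurable_const measurable_fst).inter
      ((measurableSet_le measurable_fst measurable_snd).inter
        (measurableSet_le measurable_fst (by fun_prop)))
  have h1 : ∀ p ∈ Ioi (0 : ℝ), ENNReal.ofReal (p ^ a) *
      ∫⁻ q in Ioi (0 : ℝ), ENNReal.ofReal (q ^ b) * (if p ≤ x * (p + q) then G (p + q) else 0)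
      = ∫⁻ t, H p t := by
    intro p hp
    have hp : 0 < p := hp
    have hm : Measurable fun q => ENNReal.ofReal (q ^ b) *
        (if p ≤ x * (p + q) then G (p + q) else 0) := by
      refine Measurable.mul (by fun_prop) (Measurable.ite ?_ (by fun_prop) measurable_const)
      exact measurableSet_le measurable_const (by fun_prop)
    rw [setLIntegral_congr Ioi_ae_eq_Ici, ← lintegral_indicator measurableSet_Ici,
      ← lintegral_sub_right_eq_self _ p, ← lintegral_const_mul]
    · refine lintegral_congr fun t => ?_
      by_cases h : p ≤ t <;> by_cases h' : p ≤ x * t <;> simp [H, indicator, h, h', hp]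
    · exact (hm.indicator measurableSet_Ici).comp (measurable_id.sub_const p)
  have h2 : ∀ t, ∫⁻ p in Ioi (0 : ℝ), H p t = (Ioi (0 : ℝ)).indicator (fun t =>
      (ENNReal.ofReal (t ^ (a + b + 1)) * G t) *
      ∫⁻ u in Ioc 0 x, ENNReal.ofReal (u ^ a * (1 - u) ^ b)) t := by
    intro t
    by_cases ht : 0 < t
    · rw [indicator_of_mem (mem_Ioi.2 ht), ← lintegral_indicator measurableSet_Ioi]
      have hHt : Measurable ((Ioi (0 : ℝ)).indicator fun p => H p t) :=
        (hH.comp (measurable_id.prodMk measurable_const)).indicator measurableSet_Ioi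
      rw [← Real.smul_map_volume_mul_left ht.ne', lintegral_smul_measure,
        lintegral_map hHt (by fun_prop), Real.smul_map_volume_mul_left ht.ne', smul_eq_mul,
        ← lintegral_indicator measurableSet_Ioc, ← lintegral_const_mul _ (by
          exact hHt.comp (measurable_const_mul t)),
        ← lintegral_const_mul _ (by exact Measurable.indicator (by fun_prop) measurableSet_Ioc)]
      refine lintegral_congr fun u => ?_
      have e2 : t * u ≤ x * t ↔ u ≤ x := by
        rw [mul_comm x t]; exact mul_le_mul_iff_right₀ ht
      by_cases hu : 0 < u ∧ u ≤ x
      · have hu1 : u ≤ 1 := hu.2.trans hx.2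
        have e1 : t * u ≤ t := by nlinarith
        have e3 : 0 < t * u := mul_pos ht hu.1
        have e4 : 0 ≤ 1 - u := by linarith
        rw [indicator_of_mem (mem_Ioi.2 e3), indicator_of_mem (mem_Ioc.2 hu)]
        simp only [H]
        rw [if_pos ⟨e3, e1, e2.2 hu.2⟩, abs_of_pos ht, ← mul_assoc, ← mul_assoc,
          ← ENNReal.ofReal_mul ht.le, ← ENNReal.ofReal_mul (by positivity), mul_right_comm (ENNReal.ofReal (t ^ (a + b + 1))),
          ← ENNReal.ofReal_mul (by positivity)]
        congr 2
        rw [show t - t * u = t * (1 - u) by ring, mul_pow, mul_pow]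
        ring
      · rw [indicator_of_notMem (s := Ioc 0 x) hu, mul_zero]
        have : ¬ (0 < t * u ∧ t * u ≤ t ∧ t * u ≤ x * t) := fun h =>
          hu ⟨(pos_iff_pos_of_mul_pos h.1).1 ht, e2.1 h.2.2⟩
        simp only [H, indicator]
        simp [this]
    · rw [indicator_of_notMem (by simpa using ht), lintegral_eq_zero_of_ae_eq_zero]
      refine Filter.Eventually.of_forall fun p => ?_
      simp only [H, Pi.zero_apply]
      rw [if_neg]
      rintro ⟨h1, h2, -⟩
      exact ht (h1.trans_le h2)
  rw [setLIntegral_congr_fun measurableSet_Ioi h1, lintegral_lintegral_swap hH.aemeasurable]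
  simp_rw [h2]
  rw [lintegral_indicator measurableSet_Ioi, lintegral_mul_const _ (by fun_prop)]

lemma vecMul_sq {n : ℕ} (U : Matrix.unitaryGroup (Fin n) ℂ) (z : Fin n → ℂ) :
    ∑ i, ‖(z ᵥ* U.val) i‖ ^ 2 = ∑ i, ‖z i‖ ^ 2 := by
  have key : ∀ w : Fin n → ℂ, ((∑ i, ‖w i‖ ^ 2 : ℝ) : ℂ) = w ⬝ᵥ star w := by
    intro w
    simp [dotProduct, Complex.mul_conj, Complex.normSq_eq_norm_sq]
  have hU : U.val * star U.val = 1 := Matrix.mem_unitaryGroup_iff.1 U.2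
  apply Complex.ofReal_injective
  rw [key, key, star_vecMul, ← dotProduct_mulVec, mulVec_mulVec]
  rw [Matrix.star_eq_conjTranspose] at hU
  rw [hU, one_mulVec]

lemma vecMul_measurePreserving {n : ℕ} (U : Matrix.unitaryGroup (Fin n) ℂ) :
    MeasurePreserving (fun z : Fin n → ℂ => z ᵥ* U.val) := by
  have hU : U.val * star U.val = 1 := Matrix.mem_unitaryGroup_iff.1 U.2
  have hU' : star U.val * U.val = 1 := Matrix.mem_unitaryGroup_iff'.1 U.2
  let e : (Fin n → ℂ) ≃L[ℂ] (Fin n → ℂ) := LinearEquiv.toContinuousLinearEquiv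
    { toFun := fun z => z ᵥ* U.val
      invFun := fun z => z ᵥ* star U.val
      map_add' := fun a b => add_vecMul _ _ _
      map_smul' := fun c a => by simp [smul_vecMul]
      left_inv := fun z => by simp [vecMul_vecMul, hU]
      right_inv := fun z => by simp [vecMul_vecMul, hU'] }
  have he : ∀ z, e z = z ᵥ* U.val := fun z => rfl
  have : (Measure.map e (volume : Measure (Fin n → ℂ))).IsAddHaarMeasure :=
    e.isAddHaarMeasure_map volume
  have h := Measure.isAddLeftInvariant_eq_smul (Measure.map e volume) (volume : Measure (Fin n → ℂ))
  set c := Measure.addHaarScalarFactor (Measure.map e volume) (volume : Measure (Fin n → ℂ))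
  let S : Set (Fin n → ℂ) := {z | ∑ i, ‖z i‖ ^ 2 < 1}
  have hSo : IsOpen S := isOpen_lt (by fun_prop) continuous_const
  have hpos : volume S ≠ 0 := (hSo.measure_pos volume ⟨0, by simp [S]⟩).ne'
  have hfin : volume S ≠ ⊤ := by
    refine (lt_of_le_of_lt (measure_mono (t := Metric.closedBall 0 1) ?_)
      (isCompact_closedBall (0 : Fin n → ℂ) 1).measure_lt_top).ne
    intro z hz
    rw [mem_closedBall_zero_iff, pi_norm_le_iff_of_nonneg zero_le_one]
    intro i
    have h1 : ‖z i‖ ^ 2 ≤ ∑ i, ‖z i‖ ^ 2 :=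
      Finset.single_le_sum (f := fun i => ‖z i‖ ^ 2) (fun i _ => by positivity) (Finset.mem_univ i)
    have h2 : ∑ i, ‖z i‖ ^ 2 < 1 := hz
    nlinarith [norm_nonneg (z i)]
  have hS : Measure.map e volume S = volume S := by
    rw [Measure.map_apply e.continuous.measurable hSo.measurableSet]
    congr 1
    ext z
    simp only [S, mem_preimage, mem_ofPred_eq, he, vecMul_sq]
  have hc : (c : ℝ≥0∞) = 1 := by
    rw [h] at hS
    have : (c : ℝ≥0∞) * volume S = 1 * volume S := by rw [one_mul]; exact hS
    exact (ENNReal.mul_left_inj hpos hfin).1 this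
  refine ⟨e.continuous.measurable, ?_⟩
  change Measure.map e volume = volume
  rw [h]
  have : c = 1 := by exact_mod_cast hc
  rw [this, one_smul]

lemma exists_unitary_row {n : ℕ} (i₀ : Fin n) (z : Fin n → ℂ) (hz : 0 < ∑ i, ‖z i‖ ^ 2) :
    ∃ V : Matrix.unitaryGroup (Fin n) ℂ,
      ∀ j, z j = (√(∑ i, ‖z i‖ ^ 2) : ℂ) * V.val i₀ j := by
  set s := √(∑ i, ‖z i‖ ^ 2) with hs
  have hs0 : 0 < s := Real.sqrt_pos.2 hz
  let v : Fin n → EuclideanSpace ℂ (Fin n) := fun _ => (s : ℂ)⁻¹ • WithLp.toLp 2 z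
  have hn : ‖(WithLp.toLp 2 z : EuclideanSpace ℂ (Fin n))‖ = s := by
    rw [EuclideanSpace.norm_eq]
  have hv : Orthonormal ℂ (({i₀} : Set (Fin n)).domRestrict v) := by
    constructor
    · intro i
      simp [v, norm_smul, hn, abs_of_pos hs0, hs0.ne']
    · intro i j hij
      exact absurd (Subsingleton.elim i j) hij
  obtain ⟨b, hb⟩ := hv.exists_orthonormalBasis_extension_of_card_eq (by simp)
  refine ⟨⟨Matrix.of fun i j => b i j, ?_⟩, fun j => ?_⟩
  · rw [Matrix.mem_unitaryGroup_iff]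
    ext i j
    have := b.inner_eq_ite j i
    rw [PiLp.inner_apply] at this
    simp only [RCLike.inner_apply] at this
    rw [Matrix.mul_apply, Matrix.one_apply]
    simp only [Matrix.star_apply, Matrix.of_apply, RCLike.star_def]
    rw [this]
    simp [eq_comm]
  · simp only [Matrix.of_apply, hb i₀ rfl, v]
    have : (s : ℂ) ≠ 0 := by exact_mod_cast hs0.ne'
    simp [this]

/-- The left-invariance argument: averaging a unitarily-invariant integral over `U(n)`. -/
lemma haar_average {n : ℕ} (i₀ : Fin n) (p : Fin n → Prop) [DecidablePred p]
    (μ : Measure (Matrix.unitaryGroup (Fin n) ℂ)) [IsProbabilityMeasure μ]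
    [μ.IsMulLeftInvariant] (x : ℝ) (G : ℝ → ℝ≥0∞) (hG : Measurable G) (hG0 : G 0 = 0) :
    ∫⁻ z : Fin n → ℂ, (if ∑ i with p i, ‖z i‖ ^ 2 ≤ x * ∑ i, ‖z i‖ ^ 2 then
        G (∑ i, ‖z i‖ ^ 2) else 0) =
      μ {U | ∑ i with p i, ‖U.val i₀ i‖ ^ 2 ≤ x} * ∫⁻ z : Fin n → ℂ, G (∑ i, ‖z i‖ ^ 2) := by
  have : BorelSpace (Matrix.unitaryGroup (Fin n) ℂ) := ⟨rfl⟩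
  have hent : ∀ i j, Measurable fun U : Matrix.unitaryGroup (Fin n) ℂ => U.val i j := by
    intro i j
    have h0 : Continuous fun U : Matrix.unitaryGroup (Fin n) ℂ => U.val := continuous_subtype_val
    exact (h0.matrix_elem i j).measurable
  set f : (Fin n → ℂ) → ℝ≥0∞ := fun z => if ∑ i with p i, ‖z i‖ ^ 2 ≤ x * ∑ i, ‖z i‖ ^ 2 then
        G (∑ i, ‖z i‖ ^ 2) else 0 with hf
  have hfm : Measurable f :=
    Measurable.ite (measurableSet_le (by fun_prop) (by fun_prop)) (by fun_prop) measurable_const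
  have hjoint : Measurable fun q : Matrix.unitaryGroup (Fin n) ℂ × (Fin n → ℂ) =>
      q.2 ᵥ* q.1.val := by
    refine measurable_pi_lambda _ fun j => ?_
    simp only [vecMul, dotProduct]
    refine Finset.measurable_sum _ fun i _ => Measurable.mul (by fun_prop) ?_
    exact (hent i j).comp measurable_fst
  have hset : MeasurableSet {U : Matrix.unitaryGroup (Fin n) ℂ |
      ∑ i with p i, ‖U.val i₀ i‖ ^ 2 ≤ x} :=
    measurableSet_le (Finset.measurable_sum _ fun i _ => (hent i₀ i).norm.pow_const 2)
      measurable_const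
  have h1 : ∫⁻ z, f z = ∫⁻ U, ∫⁻ z, f (z ᵥ* U.val) ∂volume ∂μ := by
    have : ∀ U : Matrix.unitaryGroup (Fin n) ℂ, ∫⁻ z, f (z ᵥ* U.val) = ∫⁻ z, f z :=
      fun U => (vecMul_measurePreserving U).lintegral_comp hfm
    simp [this]
  rw [h1, lintegral_lintegral_swap (f := fun (U : Matrix.unitaryGroup (Fin n) ℂ) z => f (z ᵥ* U.val))
    (hfm.comp hjoint).aemeasurable,
    ← lintegral_const_mul _ (by fun_prop)]
  refine lintegral_congr fun z => ?_
  rcases (Finset.sum_nonneg fun i _ => by positivity :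
    0 ≤ ∑ i, ‖z i‖ ^ 2).eq_or_lt with h0 | h0
  · simp [hf, vecMul_sq, ← h0, hG0]
  obtain ⟨V, hV⟩ := exists_unitary_row i₀ z h0
  have h2 : ∀ U : Matrix.unitaryGroup (Fin n) ℂ, f (z ᵥ* U.val) =
      ((fun U => V * U) ⁻¹' {U | ∑ i with p i, ‖U.val i₀ i‖ ^ 2 ≤ x}).indicator
        (fun _ => G (∑ i, ‖z i‖ ^ 2)) U := by
    intro U
    have h3 : ∀ j, (z ᵥ* U.val) j = (√(∑ i, ‖z i‖ ^ 2) : ℂ) * (V * U).val i₀ j := by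
      intro j
      have : (V * U).val = V.val * U.val := rfl
      rw [this, Matrix.mul_apply, Finset.mul_sum]
      simp only [vecMul, dotProduct]
      refine Finset.sum_congr rfl fun i _ => ?_
      rw [← mul_assoc, ← hV i]
    have h4 : ∑ i with p i, ‖(z ᵥ* U.val) i‖ ^ 2 =
        (∑ i, ‖z i‖ ^ 2) * ∑ i with p i, ‖(V * U).val i₀ i‖ ^ 2 := by
      rw [Finset.mul_sum]
      refine Finset.sum_congr rfl fun i _ => ?_
      rw [h3, norm_mul, mul_pow, Complex.norm_real, Real.norm_eq_abs, sq_abs, Real.sq_sqrt h0.le]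
    simp only [hf, vecMul_sq, h4, indicator, mem_preimage, mem_ofPred_eq]
    rw [mul_comm x]
    exact if_congr (mul_le_mul_iff_right₀ h0) rfl rfl
  simp_rw [h2]
  rw [lintegral_indicator_const, measure_preimage_mul, mul_comm]
  exact (measurable_const_mul V) hset

lemma lebesgue_side {n : ℕ} (p : Fin n → Prop) [DecidablePred p]
    (hp : Nonempty {i // p i}) (hnp : Nonempty {i // ¬ p i}) :
    ∃ C : ℝ≥0∞, C ≠ 0 ∧ C ≠ ⊤ ∧ ∀ x ∈ Icc (0 : ℝ) 1, ∀ G : ℝ → ℝ≥0∞, Measurable G →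
    ∫⁻ z : Fin n → ℂ, (if ∑ i with p i, ‖z i‖ ^ 2 ≤ x * ∑ i, ‖z i‖ ^ 2 then
        G (∑ i, ‖z i‖ ^ 2) else 0) =
      C * ((∫⁻ t in Ioi (0 : ℝ), ENNReal.ofReal (t ^ ((Fintype.card {i // p i} - 1) +
        (Fintype.card {i // ¬ p i} - 1) + 1)) * G t) *
      ∫⁻ u in Ioc 0 x, ENNReal.ofReal (u ^ (Fintype.card {i // p i} - 1) *
        (1 - u) ^ (Fintype.card {i // ¬ p i} - 1))) := by
  obtain ⟨C₁, h10, h1t, h1⟩ := lintegral_sq_law {i // p i}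
  obtain ⟨C₂, h20, h2t, h2⟩ := lintegral_sq_law {i // ¬ p i}
  refine ⟨C₁ * C₂, mul_ne_zero h10 h20, ENNReal.mul_ne_top h1t h2t, fun x hx G hG => ?_⟩
  rw [← beta_conv _ _ x hx G hG]
  let K : ℝ × ℝ → ℝ≥0∞ := fun q => if q.1 ≤ x * (q.1 + q.2) then G (q.1 + q.2) else 0
  have hK : Measurable K :=
    Measurable.ite (measurableSet_le (by fun_prop) (by fun_prop)) (by fun_prop) measurable_const
  have e1 : ∀ z : Fin n → ℂ, (if ∑ i with p i, ‖z i‖ ^ 2 ≤ x * ∑ i, ‖z i‖ ^ 2 then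
        G (∑ i, ‖z i‖ ^ 2) else 0) =
      (fun w : ({i // p i} → ℂ) × ({i // ¬ p i} → ℂ) =>
        K (∑ i, ‖w.1 i‖ ^ 2, ∑ i, ‖w.2 i‖ ^ 2))
        (MeasurableEquiv.piEquivPiSubtypeProd (fun _ => ℂ) p z) := by
    intro z
    have a1 : ∑ i with p i, ‖z i‖ ^ 2 = ∑ i : {i // p i}, ‖z i‖ ^ 2 :=
      Finset.sum_subtype _ (by simp) _
    have a2 : ∑ i, ‖z i‖ ^ 2 = ∑ i : {i // p i}, ‖z i‖ ^ 2 + ∑ i : {i // ¬ p i}, ‖z i‖ ^ 2 :=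
      (Fintype.sum_subtype_add_sum_subtype p fun i => ‖z i‖ ^ 2).symm
    rw [a1, a2]
    rfl
  simp_rw [e1]
  have hKm : Measurable fun w : ({i // p i} → ℂ) × ({i // ¬ p i} → ℂ) =>
        K (∑ i, ‖w.1 i‖ ^ 2, ∑ i, ‖w.2 i‖ ^ 2) := hK.comp (by fun_prop)
  rw [(volume_preserving_piEquivPiSubtypeProd (fun _ : Fin n => ℂ) p).lintegral_comp hKm,
    Measure.volume_eq_prod, lintegral_prod _ hKm.aemeasurable]
  have e2 : ∀ a : {i // p i} → ℂ, ∫⁻ b : {i // ¬ p i} → ℂ,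
      K (∑ i, ‖a i‖ ^ 2, ∑ i, ‖b i‖ ^ 2) =
      (fun s => C₂ * ∫⁻ t in Ioi (0 : ℝ),
        ENNReal.ofReal (t ^ (Fintype.card {i // ¬ p i} - 1)) * K (s, t)) (∑ i, ‖a i‖ ^ 2) :=
    fun a => h2 (fun t => K (∑ i, ‖a i‖ ^ 2, t)) (by fun_prop)
  have hm : Measurable fun s => ∫⁻ t in Ioi (0 : ℝ),
      ENNReal.ofReal (t ^ (Fintype.card {i // ¬ p i} - 1)) * K (s, t) := by
    refine Measurable.lintegral_prod_right' (f := fun q : ℝ × ℝ =>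
      ENNReal.ofReal (q.2 ^ (Fintype.card {i // ¬ p i} - 1)) * K q) (by fun_prop)
  simp_rw [e2]
  rw [h1 _ (hm.const_mul C₂), mul_assoc]
  congr 1
  rw [← lintegral_const_mul _ (by fun_prop)]
  refine lintegral_congr fun s => ?_
  rw [mul_left_comm]

lemma beta_toReal (a b : ℕ) (x : ℝ) (hx : x ∈ Icc (0 : ℝ) 1) :
    ∫⁻ u in Ioc 0 x, ENNReal.ofReal (u ^ a * (1 - u) ^ b) =
      ENNReal.ofReal (∫ u in (0 : ℝ)..x, u ^ a * (1 - u) ^ b) := by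
  have hc : Continuous fun u : ℝ => u ^ a * (1 - u) ^ b := by fun_prop
  rw [intervalIntegral.integral_of_le hx.1, ofReal_integral_eq_lintegral_ofReal
    (hc.integrableOn_Ioc)]
  refine (ae_restrict_iff' measurableSet_Ioc).2 (Filter.Eventually.of_forall fun u hu => ?_)
  have h0 : 0 ≤ u := hu.1.le
  have h1 : 0 ≤ 1 - u := by linarith [hu.2, hx.2]
  simp only [Pi.zero_apply]
  positivity

/-- for `μ` the Haar probability measure on `U(N)`, `N ≥ 2` and
`1 ≤ k ≤ N−1`, the partial sum `Σ_{i=1}^{k} |U_{1,i}|²` of squared magnitudes of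
a row has CDF `B(x; k, N−k)/B(1; k, N−k)` on `[0,1]`, where
`B(x; a, b) = ∫₀ˣ u^{a−1}(1−u)^{b−1} du` is the incomplete beta function. -/
theorem haar_unitary_partial_row_sum_cdf (N k : ℕ) (hN : 2 ≤ N)
    (hk1 : 1 ≤ k) (hk : k ≤ N - 1)
    (μ : Measure (Matrix.unitaryGroup (Fin N) ℂ)) [IsProbabilityMeasure μ]
    [μ.IsMulLeftInvariant] (x : ℝ) (hx : x ∈ Set.Icc (0 : ℝ) 1) :
    (μ {U : Matrix.unitaryGroup (Fin N) ℂ |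
        ∑ i ∈ Finset.univ.filter (fun i : Fin N => (i : ℕ) < k),
          ‖U.val ⟨0, by omega⟩ i‖ ^ 2 ≤ x}).toReal =
      (∫ u in (0 : ℝ)..x, u ^ (k - 1) * (1 - u) ^ (N - k - 1)) /
      (∫ u in (0 : ℝ)..1, u ^ (k - 1) * (1 - u) ^ (N - k - 1)) := by
  have hp : Nonempty {i : Fin N // (i : ℕ) < k} := ⟨⟨⟨0, by omega⟩, by simp; omega⟩⟩
  have hnp : Nonempty {i : Fin N // ¬ (i : ℕ) < k} := ⟨⟨⟨k, by omega⟩, by simp⟩⟩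
  have hc1 : Fintype.card {i : Fin N // (i : ℕ) < k} = k := by
    rw [Fintype.card_subtype, Fin.card_filter_val_lt]; omega
  have hc2 : Fintype.card {i : Fin N // ¬ (i : ℕ) < k} = N - k := by
    rw [Fintype.card_subtype_compl, hc1, Fintype.card_fin]
  obtain ⟨C, hC0, hCt, hC⟩ := lebesgue_side (fun i : Fin N => (i : ℕ) < k) hp hnp
  rw [hc1, hc2] at hC
  let G : ℝ → ℝ≥0∞ := (Ioc (0 : ℝ) 1).indicator 1
  have hG : Measurable G := measurable_one.indicator measurableSet_Ioc
  have hG0 : G 0 = 0 := by simp [G]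
  have hav := haar_average (⟨0, by omega⟩ : Fin N) (fun i : Fin N => (i : ℕ) < k) μ x G hG hG0
  have h1 : ∫⁻ z : Fin N → ℂ, G (∑ i, ‖z i‖ ^ 2) = ∫⁻ z : Fin N → ℂ,
      (if ∑ i with (fun i : Fin N => (i : ℕ) < k) i, ‖z i‖ ^ 2 ≤ 1 * ∑ i, ‖z i‖ ^ 2 then
        G (∑ i, ‖z i‖ ^ 2) else 0) := by
    refine lintegral_congr fun z => ?_
    rw [if_pos]
    rw [one_mul]
    exact Finset.sum_le_sum_of_subset_of_nonneg (Finset.filter_subset _ _)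
      fun i _ _ => by positivity
  rw [h1, hC x hx G hG, hC 1 (by simp) G hG, beta_toReal _ _ x hx,
    beta_toReal _ _ 1 (by simp)] at hav
  set T := ∫⁻ t in Ioi (0 : ℝ), ENNReal.ofReal (t ^ (k - 1 + (N - k - 1) + 1)) * G t with hT
  set m := k - 1 + (N - k - 1) + 1
  have hTv : T = ENNReal.ofReal (∫ u in (0 : ℝ)..1, u ^ m * (1 - u) ^ 0) := by
    rw [← beta_toReal _ _ 1 (by simp), hT, ← lintegral_indicator measurableSet_Ioi,
      ← lintegral_indicator measurableSet_Ioc]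
    refine lintegral_congr fun t => ?_
    by_cases h : 0 < t <;> by_cases h' : t ≤ 1 <;> simp [G, indicator, h, h']
  have hT0 : T ≠ 0 := by
    rw [hTv]
    simp
    positivity
  have hTt : T ≠ ⊤ := by rw [hTv]; exact ENNReal.ofReal_ne_top
  have hB0 : ∀ y ∈ Icc (0 : ℝ) 1, 0 ≤ ∫ u in (0 : ℝ)..y, u ^ (k - 1) * (1 - u) ^ (N - k - 1) := by
    intro y hy
    refine intervalIntegral.integral_nonneg hy.1 fun u hu => ?_
    have h0 : 0 ≤ u := hu.1
    have h1 : 0 ≤ 1 - u := by linarith [hu.2, hy.2]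
    positivity
  have hBpos : 0 < ∫ u in (0 : ℝ)..1, u ^ (k - 1) * (1 - u) ^ (N - k - 1) := by
    refine intervalIntegral.intervalIntegral_pos_of_pos_on
      (Continuous.intervalIntegrable (by fun_prop) _ _) (fun u hu => ?_) one_pos
    have h0 : 0 < u := hu.1
    have h1 : 0 < 1 - u := by linarith [hu.2]
    positivity
  rw [mul_left_comm (μ _) C, mul_left_comm (μ _) T] at hav
  have hav2 := (ENNReal.mul_right_inj hT0 hTt).1 ((ENNReal.mul_right_inj hC0 hCt).1 hav)
  have hav3 := congrArg ENNReal.toReal hav2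
  rw [ENNReal.toReal_mul, ENNReal.toReal_ofReal (hB0 x hx), ENNReal.toReal_ofReal hBpos.le] at hav3
  rw [eq_div_iff hBpos.ne']
  exact hav3.symm
end

section
/- Let N_t ≥ 2, C > 0, and let h = (h₁, …, h_{N_t}) be uniformly distributed on the sphere {h ∈ ℂ^{N_t} : Σ_{i=1}^{N_t} |h_i|² = 2^C − 1}. For a nonempty subset S ⊆ {1, …, N_t} with |S| = k ≤ N_t − 1, define C(S) = (N_t/k)·log₂(1 + Σ_{i∈S} |h_i|²). Then for every R with 0 ≤ R ≤ C: P(C(S) < R) = B((2^{R·k/N_t} − 1)/(2^C − 1); k, N_t − k)/B(1; k, N_t − k), where B(x; a, b) = ∫₀ˣ u^{a−1}(1−u)^{b−1} du is the incomplete beta function. -/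
open MeasureTheory

section MacHelpers

open Set
open scoped ENNReal

lemma mac_lintegral_norm {E : Type*} [NormedAddCommGroup E] [NormedSpace ℝ E] [Nontrivial E]
    [FiniteDimensional ℝ E] [MeasurableSpace E] [BorelSpace E] (μ : Measure E)
    [μ.IsAddHaarMeasure] (f : ℝ → ℝ≥0∞) (hf : Measurable f) :
    ∫⁻ x, f ‖x‖ ∂μ = μ.toSphere univ *
      ∫⁻ y in Ioi (0 : ℝ), ENNReal.ofReal (y ^ (Module.finrank ℝ E - 1)) * f y := by
  have h1 : ∫⁻ x, f ‖x‖ ∂μ = ∫⁻ x : ({(0)}ᶜ : Set E), f (‖x.1‖) ∂(μ.comap (↑)) := by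
    rw [lintegral_subtype_comap (measurableSet_singleton _).compl (fun x ↦ f (‖x‖)),
        restrict_compl_singleton]
  have h2 : ∫⁻ x : ({(0)}ᶜ : Set E), f (‖x.1‖) ∂(μ.comap (↑)) =
      ∫⁻ x, f x.2 ∂μ.toSphere.prod (.volumeIoiPow (Module.finrank ℝ E - 1)) := by
    simpa using μ.measurePreserving_homeomorphUnitSphereProd.lintegral_comp_emb
        (Homeomorph.measurableEmbedding _) (f ∘ Subtype.val ∘ Prod.snd)
  rw [h1, h2, lintegral_prod _ (by fun_prop)]
  simp only [lintegral_const]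
  rw [mul_comm, Measure.volumeIoiPow, lintegral_withDensity_eq_lintegral_mul _ (by fun_prop) (by fun_prop)]
  rw [← lintegral_subtype_comap measurableSet_Ioi]
  rfl

lemma mac_lintegral_sq (k : ℕ) (hk : 0 < k) (f : ℝ → ℝ≥0∞) :
    ∫⁻ a in Ioi (0 : ℝ), ENNReal.ofReal (a ^ (k - 1)) * f a =
      2 * ∫⁻ y in Ioi (0 : ℝ), ENNReal.ofReal (y ^ (2 * k - 1)) * f (y ^ 2) := by
  have him : (fun y : ℝ => y ^ 2) '' Ioi 0 = Ioi 0 := by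
    ext a
    simp only [mem_image, mem_Ioi]
    constructor
    · rintro ⟨y, hy, rfl⟩; positivity
    · intro ha
      exact ⟨√a, Real.sqrt_pos.2 ha, Real.sq_sqrt ha.le⟩
  have hinj : InjOn (fun y : ℝ => y ^ 2) (Ioi 0) := by
    intro x hx y hy h
    exact (pow_left_inj₀ (le_of_lt hx) (le_of_lt hy) two_ne_zero).1 h
  have := lintegral_image_eq_lintegral_abs_deriv_mul (f := fun y : ℝ => y ^ 2)
    (f' := fun y => 2 * y) measurableSet_Ioi
    (fun x _ => by simpa using (hasDerivAt_pow 2 x).hasDerivWithinAt) hinj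
    (fun a => ENNReal.ofReal (a ^ (k - 1)) * f a)
  rw [him] at this
  rw [this, ← lintegral_const_mul' _ _ (by simp)]
  refine setLIntegral_congr_fun measurableSet_Ioi (fun y hy => ?_)
  have hy : 0 < y := hy
  have h2 : y ^ (2 * k - 1) = y * (y ^ 2) ^ (k - 1) := by
    rw [← pow_mul, ← pow_succ']
    congr 1
    omega
  rw [abs_of_pos (by positivity), ENNReal.ofReal_mul (by norm_num), h2, ENNReal.ofReal_mul hy.le,
    ENNReal.ofReal_ofNat]
  ring

lemma mac_radial {E : Type*} [NormedAddCommGroup E] [NormedSpace ℝ E] [Nontrivial E]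
    [FiniteDimensional ℝ E] [MeasurableSpace E] [BorelSpace E] (μ : Measure E)
    [μ.IsAddHaarMeasure] (k : ℕ) (hk : 0 < k) (hd : Module.finrank ℝ E = 2 * k) :
    ∃ c : ℝ≥0∞, ∀ f : ℝ → ℝ≥0∞, Measurable f →
    ∫⁻ x, f (‖x‖ ^ 2) ∂μ = c *
      ∫⁻ a in Ioi (0 : ℝ), ENNReal.ofReal (a ^ (k - 1)) * f a := by
  refine ⟨μ.toSphere univ * 2⁻¹, fun f hf => ?_⟩
  rw [mac_lintegral_norm μ (fun y => f (y ^ 2)) (by fun_prop), mac_lintegral_sq k hk, hd, mul_assoc,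
    ← mul_assoc 2⁻¹, ENNReal.inv_mul_cancel (by simp) (by simp), one_mul]

/-- scaling -/
lemma mac_scale (s : ℝ) (hs : 0 < s) (f : ℝ → ℝ≥0∞) (hf : Measurable f) :
    ∫⁻ a, f a = ENNReal.ofReal s * ∫⁻ u, f (s * u) := by
  conv_lhs => rw [← Real.smul_map_volume_mul_left hs.ne']
  rw [lintegral_smul_measure, lintegral_map hf (by fun_prop), abs_of_pos hs]
  rfl

lemma mac_betagamma (k m : ℕ) (hk : 0 < k) (hm : 0 < m) :
    ∃ c : ℝ≥0∞, ∀ U : Set ℝ, MeasurableSet U →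
      ∫⁻ a in Ioi (0 : ℝ), ENNReal.ofReal (a ^ (k - 1)) *
        (∫⁻ b in Ioi (0 : ℝ), ENNReal.ofReal (b ^ (m - 1)) *
          ({p : ℝ × ℝ | p.1 + p.2 < 1 ∧ p.1 / (p.1 + p.2) ∈ U}).indicator 1 (a, b)) =
      c * ∫⁻ u in Ioo (0 : ℝ) 1 ∩ U, ENNReal.ofReal (u ^ (k - 1) * (1 - u) ^ (m - 1)) := by
  refine ⟨∫⁻ s in Ioo (0 : ℝ) 1, ENNReal.ofReal (s ^ (k + m - 1)), fun U hU => ?_⟩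
  -- the joint function of (a, s)
  let D : Set (ℝ × ℝ) := {p | 0 < p.1 ∧ p.1 < p.2 ∧ p.2 < 1 ∧ p.1 / p.2 ∈ U}
  have hD : MeasurableSet D := by
    refine MeasurableSet.inter (measurableSet_lt measurable_const measurable_fst) ?_
    refine MeasurableSet.inter (measurableSet_lt measurable_fst measurable_snd) ?_
    refine MeasurableSet.inter (measurableSet_lt measurable_snd measurable_const) ?_
    exact (measurable_fst.div measurable_snd) hU
  let G : ℝ × ℝ → ℝ≥0∞ := D.indicator
    (fun p => ENNReal.ofReal (p.1 ^ (k - 1) * (p.2 - p.1) ^ (m - 1)))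
  have hG : Measurable G := Measurable.indicator (by fun_prop) hD
  have h1 : ∫⁻ a in Ioi (0 : ℝ), ENNReal.ofReal (a ^ (k - 1)) *
        (∫⁻ b in Ioi (0 : ℝ), ENNReal.ofReal (b ^ (m - 1)) *
          ({p : ℝ × ℝ | p.1 + p.2 < 1 ∧ p.1 / (p.1 + p.2) ∈ U}).indicator 1 (a, b)) =
      ∫⁻ a, ∫⁻ s, G (a, s) := by
    rw [← lintegral_indicator measurableSet_Ioi]
    refine lintegral_congr fun a => ?_
    by_cases ha : 0 < a
    · rw [indicator_of_mem (show a ∈ Ioi 0 from ha), ← lintegral_const_mul' _ _ (by simp),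
        ← lintegral_indicator measurableSet_Ioi,
        ← lintegral_add_left_eq_self (fun s => G (a, s)) a]
      refine lintegral_congr fun b => ?_
      by_cases hb : 0 < b
      · rw [indicator_of_mem (show b ∈ Ioi 0 from hb)]
        by_cases h : a + b < 1 ∧ a / (a + b) ∈ U
        · rw [indicator_of_mem (show (a, b) ∈ {p : ℝ × ℝ | p.1 + p.2 < 1 ∧ p.1 / (p.1 + p.2) ∈ U} from h)]
          simp only [G]
          rw [indicator_of_mem (show (a, a + b) ∈ D from ⟨ha, by simpa using hb, h.1, h.2⟩)]
          simp only [Pi.one_apply, mul_one, add_sub_cancel_left]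
          rw [ENNReal.ofReal_mul (by positivity)]
        · rw [indicator_of_notMem (show (a, b) ∉ {p : ℝ × ℝ | p.1 + p.2 < 1 ∧ p.1 / (p.1 + p.2) ∈ U} from h)]
          simp only [G]
          rw [indicator_of_notMem (show (a, a + b) ∉ D from fun h' => h ⟨h'.2.2.1, h'.2.2.2⟩)]
          simp
      · rw [indicator_of_notMem (show b ∉ Ioi 0 from hb)]
        simp only [G]
        rw [indicator_of_notMem (show (a, a + b) ∉ D from fun h' => hb (by simpa using h'.2.1))]
    · rw [indicator_of_notMem (show a ∉ Ioi 0 from ha)]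
      symm
      rw [lintegral_eq_zero_iff (by fun_prop)]
      filter_upwards with s
      exact indicator_of_notMem (fun h' => ha h'.1) _
  rw [h1, lintegral_lintegral_swap (f := fun a s => G (a, s)) hG.aemeasurable, ← lintegral_mul_const' _ _ ?_]
  · rw [← lintegral_indicator measurableSet_Ioo]
    refine lintegral_congr fun s => ?_
    by_cases hs : s ∈ Ioo (0 : ℝ) 1
    · rw [indicator_of_mem hs, mac_scale s hs.1 (fun a => G (a, s)) (by fun_prop),
        ← lintegral_const_mul' _ _ (by simp), ← lintegral_indicator (measurableSet_Ioo.inter hU),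
        ← lintegral_const_mul' _ _ (by simp)]
      refine lintegral_congr fun u => ?_
      have hs0 := hs.1
      by_cases hu : u ∈ Ioo (0 : ℝ) 1 ∩ U
      · obtain ⟨⟨hu0, hu1⟩, huU⟩ := hu
        rw [indicator_of_mem (show u ∈ Ioo (0 : ℝ) 1 ∩ U from ⟨⟨hu0, hu1⟩, huU⟩)]
        simp only [G]
        rw [indicator_of_mem (show (s * u, s) ∈ D from ⟨by positivity, by simp only; nlinarith, hs.2, by
          simp only; rwa [mul_div_cancel_left₀ _ hs0.ne']⟩), ← ENNReal.ofReal_mul hs0.le,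
          ← ENNReal.ofReal_mul (by positivity)]
        congr 1
        simp only
        rw [show s - s * u = s * (1 - u) by ring, mul_pow, mul_pow,
          show k + m - 1 = 1 + (k - 1) + (m - 1) by omega, pow_add, pow_add]
        ring
      · rw [indicator_of_notMem hu]
        simp only [G]
        rw [indicator_of_notMem, mul_zero, mul_zero]
        rintro ⟨h1, h2, h3, h4⟩
        simp only at h1 h2 h3 h4
        rw [mul_div_cancel_left₀ _ hs0.ne'] at h4
        exact hu ⟨⟨pos_of_mul_pos_right h1 hs0.le, by nlinarith⟩, h4⟩
    · rw [indicator_of_notMem hs]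
      rw [lintegral_eq_zero_iff (by fun_prop)]
      filter_upwards with a
      exact indicator_of_notMem (fun h' => hs ⟨h'.1.trans h'.2.1, h'.2.2.1⟩) _
  · refine ne_of_lt (lt_of_le_of_lt (lintegral_mono_set inter_subset_left) ?_)
    refine lt_of_le_of_lt (setLIntegral_mono' (g := fun _ => 1) measurableSet_Ioo ?_) ?_
    · intro u hu
      rw [ENNReal.ofReal_le_one]
      exact mul_le_one₀ (pow_le_one₀ hu.1.le hu.2.le) (pow_nonneg (by linarith [hu.2]) _)
        (pow_le_one₀ (by linarith [hu.2]) (by linarith [hu.1]))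
    · simp

instance mac_borel {n : ℕ} : BorelSpace (EuclideanSpace ℂ (Fin n)) := ⟨rfl⟩

noncomputable def macReal {n : ℕ} (e : EuclideanSpace ℂ (Fin n) ≃ₗᵢ[ℂ] EuclideanSpace ℂ (Fin n)) :
    EuclideanSpace ℂ (Fin n) ≃ₗᵢ[ℝ] EuclideanSpace ℂ (Fin n) where
  toLinearEquiv := e.toLinearEquiv.restrictScalars ℝ
  norm_map' := e.norm_map

lemma mac_inner {n : ℕ} (e : EuclideanSpace ℂ (Fin n) ≃ₗᵢ[ℂ] EuclideanSpace ℂ (Fin n))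
    (x y : EuclideanSpace ℂ (Fin n)) : inner ℝ (e x) (e y) = inner ℝ x y :=
  (macReal e).inner_map_map x y

lemma mac_transitive {n : ℕ} (s t : EuclideanSpace ℂ (Fin n)) (h : ‖s‖ = ‖t‖) :
    ∃ e : EuclideanSpace ℂ (Fin n) ≃ₗᵢ[ℂ] EuclideanSpace ℂ (Fin n), e s = t := by
  by_cases hs : s = 0
  · subst hs
    have : t = 0 := by simpa using h.symm
    exact ⟨LinearIsometryEquiv.refl ℂ _, by simp [this]⟩
  have hs' : ‖s‖ ≠ 0 := by simpa using hs
  have hn : 0 < n := by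
    rcases Nat.eq_zero_or_pos n with rfl | hn
    · exact absurd (Subsingleton.elim s 0) hs
    · exact hn
  let i0 : Fin n := ⟨0, hn⟩
  have key : ∀ x : EuclideanSpace ℂ (Fin n), ‖x‖ = ‖s‖ →
      ∃ b : OrthonormalBasis (Fin n) ℂ (EuclideanSpace ℂ (Fin n)),
        b i0 = ((‖s‖ : ℂ)⁻¹) • x := by
    intro x hx
    have ho : Orthonormal ℂ (({i0} : Set (Fin n)).domRestrict
        (fun _ => ((‖s‖ : ℂ)⁻¹) • x)) := by
      constructor
      · intro i
        change ‖((‖s‖ : ℂ)⁻¹) • x‖ = 1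
        rw [norm_smul, hx]
        simp [hs']
      · intro i j hij
        exact absurd (Subsingleton.elim i j) hij
    obtain ⟨b, hb⟩ := ho.exists_orthonormalBasis_extension_of_card_eq (by simp)
    exact ⟨b, hb i0 rfl⟩
  obtain ⟨b, hb⟩ := key s rfl
  obtain ⟨b', hb'⟩ := key t h.symm
  refine ⟨b.equiv b' (Equiv.refl _), ?_⟩
  have h1 : b.equiv b' (Equiv.refl _) (b i0) = b' i0 := by simp
  rw [hb, hb', map_smul] at h1
  exact smul_right_injective _ (by simpa using hs) h1

lemma mac_charFun_inv {n : ℕ} (μ : Measure (EuclideanSpace ℂ (Fin n)))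
    (hinv : ∀ e : EuclideanSpace ℂ (Fin n) ≃ₗᵢ[ℂ] EuclideanSpace ℂ (Fin n),
      Measure.map e μ = μ) (s t : EuclideanSpace ℂ (Fin n)) (h : ‖s‖ = ‖t‖) :
    charFun μ s = charFun μ t := by
  obtain ⟨e, rfl⟩ := mac_transitive s t h
  conv_rhs => rw [← hinv e]
  have he : Measurable e := e.continuous.measurable
  rw [charFun_apply, charFun_apply, integral_map he.aemeasurable (by fun_prop)]
  simp_rw [mac_inner]

lemma mac_unique {n : ℕ} (r : ℝ) (hr : 0 < r) (μ ν : Measure (EuclideanSpace ℂ (Fin n)))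
    [IsProbabilityMeasure μ] [IsProbabilityMeasure ν]
    (hμ : ∀ᵐ x ∂μ, ‖x‖ = r) (hν : ∀ᵐ x ∂ν, ‖x‖ = r)
    (hμi : ∀ e : EuclideanSpace ℂ (Fin n) ≃ₗᵢ[ℂ] EuclideanSpace ℂ (Fin n), Measure.map e μ = μ)
    (hνi : ∀ e : EuclideanSpace ℂ (Fin n) ≃ₗᵢ[ℂ] EuclideanSpace ℂ (Fin n), Measure.map e ν = ν) :
    μ = ν := by
  refine Measure.ext_of_charFun (funext fun t => ?_)
  have key : ∀ (μ ν : Measure (EuclideanSpace ℂ (Fin n))) [IsProbabilityMeasure ν],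
      (∀ᵐ x ∂ν, ‖x‖ = r) →
      (∀ e : EuclideanSpace ℂ (Fin n) ≃ₗᵢ[ℂ] EuclideanSpace ℂ (Fin n), Measure.map e μ = μ) →
      ∫ x, charFun μ ((‖t‖ / r) • x) ∂ν = charFun μ t := by
    intro μ ν _ h1 h2
    have : ∫ x, charFun μ ((‖t‖ / r) • x) ∂ν = ∫ x, charFun μ t ∂ν := by
      refine integral_congr_ae ?_
      filter_upwards [h1] with x hx
      refine mac_charFun_inv μ h2 _ _ ?_
      rw [norm_smul, hx, Real.norm_of_nonneg (by positivity)]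
      field_simp
    rw [this]; simp
  rw [← key μ ν hν hμi, ← key ν μ hμ hνi]
  simp_rw [charFun_apply]
  rw [integral_integral_swap]
  · simp_rw [inner_smul_right, real_inner_comm]
  · refine (integrable_const (1 : ℝ)).mono (Continuous.aestronglyMeasurable (by fun_prop)) ?_
    filter_upwards with x
    simp only [Function.uncurry]
    rw [Complex.norm_exp_ofReal_mul_I]; simp

lemma mac_haar_inv {n : ℕ} (l : Measure (EuclideanSpace ℂ (Fin n))) [l.IsAddHaarMeasure]
    (e : EuclideanSpace ℂ (Fin n) ≃ₗᵢ[ℂ] EuclideanSpace ℂ (Fin n)) :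
    Measure.map e l = l := by
  have h1 : Measure.map e (measureSpaceOfInnerProductSpace (E := EuclideanSpace ℂ (Fin n))).volume
     = (measureSpaceOfInnerProductSpace (E := EuclideanSpace ℂ (Fin n))).volume :=
    (macReal e).measurePreserving.map_eq
  rw [Measure.isAddLeftInvariant_eq_smul l
    (measureSpaceOfInnerProductSpace (E := EuclideanSpace ℂ (Fin n))).volume,
    Measure.map_smul, h1]

/-- the uniform law obtained from Haar measure on ball -/
lemma mac_exists_unif {n : ℕ} (hn : 0 < n) (r : ℝ) (hr : 0 < r)
    (l : Measure (EuclideanSpace ℂ (Fin n))) [l.IsAddHaarMeasure]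
    (μ : Measure (EuclideanSpace ℂ (Fin n))) [IsProbabilityMeasure μ]
    (hμ : ∀ᵐ x ∂μ, ‖x‖ = r)
    (hμi : ∀ e : EuclideanSpace ℂ (Fin n) ≃ₗᵢ[ℂ] EuclideanSpace ℂ (Fin n), Measure.map e μ = μ)
    (A : Set (EuclideanSpace ℂ (Fin n))) (hA : MeasurableSet A) :
    μ A = (l (Metric.ball 0 1))⁻¹ *
      l (((fun z : EuclideanSpace ℂ (Fin n) => (r / ‖z‖) • z) ⁻¹' A) ∩ Metric.ball 0 1) := by
  have hN : Measurable (fun z : EuclideanSpace ℂ (Fin n) => (r / ‖z‖) • z) := by fun_prop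
  have : Nonempty (Fin n) := ⟨⟨0, hn⟩⟩
  have : Nontrivial (EuclideanSpace ℂ (Fin n)) := inferInstance
  have hb0 : l (Metric.ball 0 1) ≠ 0 := (Metric.measure_ball_pos l 0 one_pos).ne'
  have hbt : l (Metric.ball 0 1) ≠ ⊤ := measure_ball_lt_top.ne
  let ν : Measure (EuclideanSpace ℂ (Fin n)) := (l (Metric.ball 0 1))⁻¹ •
    Measure.map (fun z : EuclideanSpace ℂ (Fin n) => (r / ‖z‖) • z) (l.restrict (Metric.ball 0 1))
  have hνA : ∀ A, MeasurableSet A → ν A = (l (Metric.ball 0 1))⁻¹ *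
      l (((fun z : EuclideanSpace ℂ (Fin n) => (r / ‖z‖) • z) ⁻¹' A) ∩ Metric.ball 0 1) := by
    intro A hA
    simp only [ν, Measure.smul_apply, smul_eq_mul]
    rw [Measure.map_apply hN hA, Measure.restrict_apply (hN hA)]
  have : IsProbabilityMeasure ν := ⟨by
    rw [hνA _ MeasurableSet.univ]; simp [ENNReal.inv_mul_cancel hb0 hbt]⟩
  rw [← hνA A hA]
  congr 1
  refine mac_unique r hr μ ν hμ ?_ hμi ?_
  · refine Measure.ae_smul_measure ?_ _
    rw [ae_map_iff hN.aemeasurable (measurableSet_eq_fun (by fun_prop) (by fun_prop))]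
    refine ae_restrict_of_ae ?_
    have : ∀ᵐ z ∂l, z ≠ 0 := by simp [ae_iff]
    filter_upwards [this] with z hz
    have : ‖z‖ ≠ 0 := by simpa using hz
    rw [norm_smul, Real.norm_of_nonneg (by positivity)]
    field_simp
  · intro e
    have he : Measurable e := e.continuous.measurable
    ext A hA
    rw [Measure.map_apply he hA, hνA _ (he hA), hνA _ hA]
    congr 1
    conv_rhs => rw [← mac_haar_inv l e]
    rw [Measure.map_apply he ((hN hA).inter measurableSet_ball)]
    congr 1
    ext z
    have h1 : e ((r / ‖z‖) • z) = (r / ‖z‖) • e z := (macReal e).map_smul _ _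
    simp only [Set.mem_inter_iff, Set.mem_preimage, Metric.mem_ball, dist_zero_right, h1, e.norm_map]


noncomputable def macSplit {n : ℕ} (S : Finset (Fin n)) :
    (EuclideanSpace ℂ {i // i ∈ S} × EuclideanSpace ℂ {i // i ∉ S}) ≃ₗ[ℝ]
      EuclideanSpace ℂ (Fin n) where
  toFun p := WithLp.toLp 2 (fun i => if h : i ∈ S then p.1 ⟨i, h⟩ else p.2 ⟨i, h⟩)
  invFun z := (WithLp.toLp 2 (fun i => z i.1), WithLp.toLp 2 (fun i => z i.1))
  map_add' p q := by
    ext i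
    by_cases h : i ∈ S <;> simp [h]
  map_smul' c p := by
    ext i
    by_cases h : i ∈ S <;> simp [h]
  left_inv p := by
    refine Prod.ext ?_ ?_
    · ext i
      simp
    · ext i
      simp [i.2]
  right_inv z := by
    ext i
    by_cases h : i ∈ S <;> simp [h]

lemma macSplit_sum {n : ℕ} (S : Finset (Fin n))
    (p : EuclideanSpace ℂ {i // i ∈ S} × EuclideanSpace ℂ {i // i ∉ S}) :
    ∑ i ∈ S, ‖macSplit S p i‖ ^ 2 = ‖p.1‖ ^ 2 := by
  rw [EuclideanSpace.norm_sq_eq, ← Finset.sum_coe_sort S]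
  refine Finset.sum_congr rfl fun i _ => ?_
  simp [macSplit]

lemma macSplit_norm {n : ℕ} (S : Finset (Fin n))
    (p : EuclideanSpace ℂ {i // i ∈ S} × EuclideanSpace ℂ {i // i ∉ S}) :
    ‖macSplit S p‖ ^ 2 = ‖p.1‖ ^ 2 + ‖p.2‖ ^ 2 := by
  rw [EuclideanSpace.norm_sq_eq (macSplit S p), ← Finset.sum_add_sum_compl S, macSplit_sum]
  congr 1
  rw [EuclideanSpace.norm_sq_eq, Finset.sum_subtype (p := fun i => i ∉ S) (Sᶜ) (by simp)
    (fun i => ‖macSplit S p i‖ ^ 2)]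
  refine Finset.sum_congr rfl fun i _ => ?_
  simp [macSplit, i.2]

lemma mac_finrank {ι : Type*} [Fintype ι] :
    Module.finrank ℝ (EuclideanSpace ℂ ι) = 2 * Fintype.card ι := by
  rw [finrank_real_of_complex, finrank_euclideanSpace]

lemma mac_volume {n : ℕ} (S : Finset (Fin n)) (hS : S.Nonempty) (hS' : S.card < n) :
    ∃ (l : Measure (EuclideanSpace ℂ (Fin n))) (c : ℝ≥0∞), l.IsAddHaarMeasure ∧
      ∀ U : Set ℝ, MeasurableSet U →
      l {z | ‖z‖ < 1 ∧ (∑ i ∈ S, ‖z i‖ ^ 2) / ‖z‖ ^ 2 ∈ U} =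
        c * ∫⁻ u in Ioo (0 : ℝ) 1 ∩ U,
          ENNReal.ofReal (u ^ (S.card - 1) * (1 - u) ^ (n - S.card - 1)) := by
  have hk : 0 < S.card := hS.card_pos
  have hc1 : Fintype.card {i // i ∈ S} = S.card := by simp
  have hc2 : Fintype.card {i // i ∉ S} = n - S.card := by
    rw [Fintype.card_subtype_compl]; simp
  have : Nonempty {i // i ∈ S} := Fintype.card_pos_iff.1 (by omega)
  have : Nonempty {i // i ∉ S} := Fintype.card_pos_iff.1 (by omega)
  let lV : Measure (EuclideanSpace ℂ {i // i ∈ S}) := Measure.addHaar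
  let lW : Measure (EuclideanSpace ℂ {i // i ∉ S}) := Measure.addHaar
  let Φ := (macSplit S).toContinuousLinearEquiv
  obtain ⟨cV, hV⟩ := mac_radial lV S.card hk (by rw [mac_finrank, hc1])
  obtain ⟨cW, hW⟩ := mac_radial lW (n - S.card) (by omega) (by rw [mac_finrank, hc2])
  obtain ⟨c, hc⟩ := mac_betagamma S.card (n - S.card) hk (by omega)
  refine ⟨Measure.map Φ (lV.prod lW), cV * cW * c, Φ.isAddHaarMeasure_map _, fun U hU => ?_⟩
  have hT : MeasurableSet {p : ℝ × ℝ | p.1 + p.2 < 1 ∧ p.1 / (p.1 + p.2) ∈ U} := by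
    refine MeasurableSet.inter
      (measurableSet_lt (measurable_fst.add measurable_snd) measurable_const) ?_
    exact (measurable_fst.div (measurable_fst.add measurable_snd)) hU
  set T := {p : ℝ × ℝ | p.1 + p.2 < 1 ∧ p.1 / (p.1 + p.2) ∈ U} with hTdef
  have hZ : MeasurableSet {z : EuclideanSpace ℂ (Fin n) |
      ‖z‖ < 1 ∧ (∑ i ∈ S, ‖z i‖ ^ 2) / ‖z‖ ^ 2 ∈ U} := by
    refine MeasurableSet.inter (measurableSet_lt measurable_norm measurable_const) ?_
    have h1 : Measurable fun z : EuclideanSpace ℂ (Fin n) => ∑ i ∈ S, ‖z i‖ ^ 2 :=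
      Continuous.measurable (by fun_prop)
    exact (h1.div (measurable_norm.pow_const 2)) hU
  rw [Measure.map_apply Φ.continuous.measurable hZ]
  have hpre : Φ ⁻¹' {z : EuclideanSpace ℂ (Fin n) |
      ‖z‖ < 1 ∧ (∑ i ∈ S, ‖z i‖ ^ 2) / ‖z‖ ^ 2 ∈ U} =
      (fun p => (‖p.1‖ ^ 2, ‖p.2‖ ^ 2)) ⁻¹' T := by
    ext p
    have e1 : Φ p = macSplit S p := rfl
    have e2 : ‖macSplit S p‖ < 1 ↔ ‖p.1‖ ^ 2 + ‖p.2‖ ^ 2 < 1 := by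
      rw [← macSplit_norm, sq_lt_one_iff₀ (norm_nonneg _)]
    simp only [mem_preimage, mem_ofPred_eq, e1, e2, macSplit_sum, macSplit_norm, hTdef]
  have hm : Measurable (fun p : EuclideanSpace ℂ {i // i ∈ S} × EuclideanSpace ℂ {i // i ∉ S} =>
      (‖p.1‖ ^ 2, ‖p.2‖ ^ 2)) := by fun_prop
  have hI : Measurable (T.indicator (1 : ℝ × ℝ → ℝ≥0∞)) := measurable_one.indicator hT
  rw [hpre, ← lintegral_indicator_one (hm hT), lintegral_prod _ (by
    exact (measurable_one.indicator (hm hT)).aemeasurable)]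
  have h1 : ∀ v : EuclideanSpace ℂ {i // i ∈ S}, ∫⁻ w, ((fun p :
      EuclideanSpace ℂ {i // i ∈ S} × EuclideanSpace ℂ {i // i ∉ S} =>
      (‖p.1‖ ^ 2, ‖p.2‖ ^ 2)) ⁻¹' T).indicator (1 : EuclideanSpace ℂ {i // i ∈ S} × EuclideanSpace ℂ {i // i ∉ S} → ℝ≥0∞) (v, w) ∂lW =
      cW * ∫⁻ b in Ioi (0 : ℝ), ENNReal.ofReal (b ^ (n - S.card - 1)) *
        T.indicator 1 (‖v‖ ^ 2, b) := by
    intro v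
    rw [← hW (fun b => T.indicator 1 (‖v‖ ^ 2, b)) (by fun_prop)]
    rfl
  simp_rw [h1]
  have hmeas : Measurable (fun a : ℝ => ∫⁻ b in Ioi (0 : ℝ),
      ENNReal.ofReal (b ^ (n - S.card - 1)) * T.indicator 1 (a, b)) := by
    apply Measurable.lintegral_prod_right'
      (f := fun p : ℝ × ℝ => ENNReal.ofReal (p.2 ^ (n - S.card - 1)) * T.indicator 1 p)
    fun_prop
  rw [hV (fun a => cW * ∫⁻ b in Ioi (0 : ℝ), ENNReal.ofReal (b ^ (n - S.card - 1)) *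
        T.indicator 1 (a, b)) (by fun_prop)]
  simp_rw [mul_left_comm _ cW]
  rw [lintegral_const_mul _ (by fun_prop), hc U hU]
  ring

lemma mac_beta_integral (a b : ℕ) (x : ℝ) (hx0 : 0 ≤ x) (hx1 : x ≤ 1) :
    ∫⁻ u in Ioo (0 : ℝ) 1 ∩ Iio x, ENNReal.ofReal (u ^ a * (1 - u) ^ b) =
      ENNReal.ofReal (∫ u in (0 : ℝ)..x, u ^ a * (1 - u) ^ b) := by
  have h1 : Ioo (0 : ℝ) 1 ∩ Iio x = Ioo 0 x := by
    ext u
    simp only [mem_inter_iff, mem_Ioo, mem_Iio]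
    constructor
    · rintro ⟨⟨h1, h2⟩, h3⟩; exact ⟨h1, h3⟩
    · rintro ⟨h1, h2⟩; exact ⟨⟨h1, by linarith⟩, h2⟩
  have hi : IntegrableOn (fun u : ℝ => u ^ a * (1 - u) ^ b) (Ioo 0 x) :=
    (Continuous.integrableOn_Icc (by fun_prop)).mono_set Ioo_subset_Icc_self
  rw [h1, intervalIntegral.integral_of_le hx0, integral_Ioc_eq_integral_Ioo,
    ofReal_integral_eq_lintegral_ofReal hi]
  refine (ae_restrict_iff' measurableSet_Ioo).2 (Filter.Eventually.of_forall fun u hu => ?_)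
  have : 0 ≤ 1 - u := by linarith [hu.2]
  have := hu.1
  positivity

lemma mac_core {n : ℕ} (r : ℝ) (hr : 0 < r)
    (μ : Measure (EuclideanSpace ℂ (Fin n))) [IsProbabilityMeasure μ]
    (hμ : ∀ᵐ x ∂μ, ‖x‖ = r)
    (hμi : ∀ e : EuclideanSpace ℂ (Fin n) ≃ₗᵢ[ℂ] EuclideanSpace ℂ (Fin n), Measure.map e μ = μ)
    (S : Finset (Fin n)) (hS : S.Nonempty) (hS' : S.card < n) (x : ℝ) (hx0 : 0 ≤ x) (hx1 : x ≤ 1) :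
    (μ {h | ∑ i ∈ S, ‖h i‖ ^ 2 < x * r ^ 2}).toReal =
      (∫ u in (0 : ℝ)..x, u ^ (S.card - 1) * (1 - u) ^ (n - S.card - 1)) /
      (∫ u in (0 : ℝ)..1, u ^ (S.card - 1) * (1 - u) ^ (n - S.card - 1)) := by
  obtain ⟨l, c, hl, hc⟩ := mac_volume S hS hS'
  have hA : MeasurableSet {h : EuclideanSpace ℂ (Fin n) | ∑ i ∈ S, ‖h i‖ ^ 2 < x * r ^ 2} :=
    measurableSet_lt (Continuous.measurable (by fun_prop)) measurable_const
  rw [mac_exists_unif (by omega) r hr l μ hμ hμi _ hA]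
  have hb : Metric.ball (0 : EuclideanSpace ℂ (Fin n)) 1 =
      {z | ‖z‖ < 1 ∧ (∑ i ∈ S, ‖z i‖ ^ 2) / ‖z‖ ^ 2 ∈ (univ : Set ℝ)} := by
    ext z; simp
  have hb0 : l (Metric.ball 0 1) ≠ 0 := (Metric.measure_ball_pos l 0 one_pos).ne'
  have hbt : l (Metric.ball 0 1) ≠ ⊤ := measure_ball_lt_top.ne
  have hset : ((fun z : EuclideanSpace ℂ (Fin n) => (r / ‖z‖) • z) ⁻¹'
      {h | ∑ i ∈ S, ‖h i‖ ^ 2 < x * r ^ 2}) ∩ Metric.ball 0 1 =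
      {z | ‖z‖ < 1 ∧ (∑ i ∈ S, ‖z i‖ ^ 2) / ‖z‖ ^ 2 ∈ Iio x} := by
    ext z
    have h1 : ∑ i ∈ S, ‖((r / ‖z‖) • z) i‖ ^ 2 = (∑ i ∈ S, ‖z i‖ ^ 2) / ‖z‖ ^ 2 * r ^ 2 := by
      rw [Finset.sum_div, Finset.sum_mul]
      refine Finset.sum_congr rfl fun i _ => ?_
      rw [PiLp.smul_apply, norm_smul, Real.norm_of_nonneg (by positivity)]
      ring
    simp only [mem_inter_iff, mem_preimage, mem_ofPred_eq, h1, Metric.mem_ball, dist_zero_right,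
      mem_Iio]
    rw [mul_lt_mul_iff_left₀ (by positivity), and_comm]
  have hone : ∫⁻ u in Ioo (0 : ℝ) 1 ∩ univ,
      ENNReal.ofReal (u ^ (S.card - 1) * (1 - u) ^ (n - S.card - 1)) =
      ENNReal.ofReal (∫ u in (0 : ℝ)..1, u ^ (S.card - 1) * (1 - u) ^ (n - S.card - 1)) := by
    rw [← mac_beta_integral _ _ 1 zero_le_one le_rfl]
    congr 2
    ext u; simp
  have hB := hc univ MeasurableSet.univ
  rw [← hb, hone] at hB
  have hnn : ∀ y : ℝ, 0 ≤ y → y ≤ 1 →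
      0 ≤ ∫ u in (0 : ℝ)..y, u ^ (S.card - 1) * (1 - u) ^ (n - S.card - 1) := by
    intro y hy0 hy1
    refine intervalIntegral.integral_nonneg hy0 fun u hu => ?_
    have : 0 ≤ 1 - u := by linarith [hu.2]
    have := hu.1
    positivity
  rw [hset, hc _ measurableSet_Iio, mac_beta_integral _ _ x hx0 hx1, hB]
  rw [hB] at hb0 hbt
  have hI0 := right_ne_zero_of_mul hb0
  have hc0 := left_ne_zero_of_mul hb0
  have hct : c ≠ ⊤ := by
    rintro rfl
    exact hbt (ENNReal.top_mul hI0)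
  rw [ENNReal.toReal_mul, ENNReal.toReal_inv, ENNReal.toReal_mul, ENNReal.toReal_mul,
    ENNReal.toReal_ofReal (hnn x hx0 hx1), ENNReal.toReal_ofReal (hnn 1 zero_le_one le_rfl)]
  have hcr : c.toReal ≠ 0 := ENNReal.toReal_ne_zero.2 ⟨hc0, hct⟩
  have hIr : (∫ u in (0 : ℝ)..1, u ^ (S.card - 1) * (1 - u) ^ (n - S.card - 1)) ≠ 0 := by
    intro h
    rw [h] at hI0
    simp at hI0
  field_simp

end MacHelpers

/-- for `h = (h₁,…,h_{N_t})` uniformly distributed on the complex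
sphere `{h : Σᵢ |hᵢ|² = 2^C − 1}` (i.e. `μ` is a probability measure carried by
the sphere and invariant under every unitary transformation), a nonempty subset
`S` with `|S| = k ≤ N_t − 1`, and `0 ≤ R ≤ C`, the per-subset rate constraint
`C(S) = (N_t/k)·log₂(1 + Σ_{i∈S}|hᵢ|²)` satisfies
`P(C(S) < R) = B((2^{Rk/N_t} − 1)/(2^C − 1); k, N_t − k)/B(1; k, N_t − k)`. -/
theorem MAC_subset_rate_constraint_cdf (Nt : ℕ) (hNt : 2 ≤ Nt) (C R : ℝ)
    (hC : 0 < C) (hR0 : 0 ≤ R) (hRC : R ≤ C)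
    (μ : Measure (EuclideanSpace ℂ (Fin Nt))) [IsProbabilityMeasure μ]
    (hsphere : μ {h : EuclideanSpace ℂ (Fin Nt) |
        ∑ i, ‖h i‖ ^ 2 = (2 : ℝ) ^ C - 1} = 1)
    (hinv : ∀ e : EuclideanSpace ℂ (Fin Nt) ≃ₗᵢ[ℂ] EuclideanSpace ℂ (Fin Nt),
      Measure.map e μ = μ)
    (S : Finset (Fin Nt)) (hS : S.Nonempty) (hScard : S.card ≤ Nt - 1) :
    (μ {h : EuclideanSpace ℂ (Fin Nt) |
        ((Nt : ℝ) / (S.card : ℝ)) * Real.logb 2 (1 + ∑ i ∈ S, ‖h i‖ ^ 2) < R}).toReal =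
      (∫ u in (0 : ℝ)..(((2 : ℝ) ^ (R * (S.card : ℝ) / (Nt : ℝ)) - 1) / ((2 : ℝ) ^ C - 1)),
          u ^ (S.card - 1) * (1 - u) ^ (Nt - S.card - 1)) /
      (∫ u in (0 : ℝ)..1, u ^ (S.card - 1) * (1 - u) ^ (Nt - S.card - 1)) := by
  have hk : 0 < S.card := hS.card_pos
  have hkR : (0 : ℝ) < S.card := by exact_mod_cast hk
  have hnR : (0 : ℝ) < Nt := by exact_mod_cast (by omega : 0 < Nt)
  have hkn : (S.card : ℝ) ≤ Nt := by exact_mod_cast (by omega : S.card ≤ Nt)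
  have hP : 0 < (2 : ℝ) ^ C - 1 := by
    linarith [Real.one_lt_rpow (by norm_num : (1 : ℝ) < 2) hC]
  have hr2 : √((2 : ℝ) ^ C - 1) ^ 2 = (2 : ℝ) ^ C - 1 := Real.sq_sqrt hP.le
  have hr : 0 < √((2 : ℝ) ^ C - 1) := Real.sqrt_pos.2 hP
  have hE0 : 0 ≤ R * (S.card : ℝ) / (Nt : ℝ) := by positivity
  have hE1 : R * (S.card : ℝ) / (Nt : ℝ) ≤ C := by
    rw [div_le_iff₀ hnR]
    exact mul_le_mul hRC hkn hkR.le hC.le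
  have hq0 : 0 ≤ (2 : ℝ) ^ (R * (S.card : ℝ) / (Nt : ℝ)) - 1 := by
    linarith [Real.one_le_rpow (by norm_num : (1 : ℝ) ≤ 2) hE0]
  have hq1 : (2 : ℝ) ^ (R * (S.card : ℝ) / (Nt : ℝ)) ≤ (2 : ℝ) ^ C :=
    Real.rpow_le_rpow_of_exponent_le (by norm_num) hE1
  have hms : MeasurableSet {h : EuclideanSpace ℂ (Fin Nt) |
        ∑ i, ‖h i‖ ^ 2 = (2 : ℝ) ^ C - 1} :=
    measurableSet_eq_fun (Continuous.measurable (by fun_prop)) measurable_const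
  have hμ : ∀ᵐ x ∂μ, ‖x‖ = √((2 : ℝ) ^ C - 1) := by
    have h1 : ∀ᵐ x ∂μ, x ∈ {h : EuclideanSpace ℂ (Fin Nt) |
        ∑ i, ‖h i‖ ^ 2 = (2 : ℝ) ^ C - 1} := (mem_ae_iff_prob_eq_one hms).2 hsphere
    filter_upwards [h1] with x hx
    rw [EuclideanSpace.norm_eq, hx]
  rw [← mac_core _ hr μ hμ hinv S hS (by omega) _ (div_nonneg hq0 hP.le)
    ((div_le_one hP).2 (by linarith)), hr2, div_mul_cancel₀ _ hP.ne']
  congr 2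
  ext h
  have hX : 0 ≤ ∑ i ∈ S, ‖h i‖ ^ 2 := Finset.sum_nonneg fun i _ => by positivity
  simp only [Set.mem_ofPred_eq]
  rw [lt_sub_iff_add_lt', ← Real.logb_lt_iff_lt_rpow (by norm_num) (by linarith), lt_div_iff₀ hnR,
    div_mul_eq_mul_div, div_lt_iff₀ hkR, mul_comm (Nt : ℝ)]
end

section
/- Let μ be the Haar probability measure on the unitary group U(2) of 2×2 complex unitary matrices. Let 0 ≤ ρ₂ < ρ₁ and let R ≥ 0 satisfy 2^{R/2} ≤ 1 + ρ₁. Then μ{U : 2·log₂(1 + ρ₁|U₁₁|² + ρ₂|U₂₁|²) < R} = max((2^{R/2} − 1 − ρ₂)/(ρ₁ − ρ₂), 0). -/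
open MeasureTheory Matrix

instance haarAuxBorel {n : ℕ} : BorelSpace (Matrix.unitaryGroup (Fin n) ℂ) := ⟨rfl⟩

/-- Radial Gaussian tail integral over `ℂ`. -/
lemma gauss_tail (c k : ℝ) (hc : 0 < c) (hk : 0 ≤ k) :
    ∫⁻ b : ℂ, Set.indicator {b : ℂ | k < ‖b‖ ^ 2}
      (fun b => ENNReal.ofReal (Real.exp (-c * ‖b‖ ^ 2))) b
      = ENNReal.ofReal (Real.pi / c * Real.exp (-c * k)) := by
  rw [← Complex.lintegral_comp_polarCoord_symm]
  have hg : ∀ x ∈ Set.Ici (√k), HasDerivAt (fun r : ℝ => -(1 / (2 * c)) * Real.exp (-c * r ^ 2))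
      (x * Real.exp (-c * x ^ 2)) x := by
    intro x _
    have h1 : HasDerivAt (fun r : ℝ => -c * r ^ 2) (-c * (2 * x)) x := by
      simpa using (hasDerivAt_pow 2 x).const_mul (-c)
    refine (h1.exp.const_mul (-(1 / (2 * c)))).congr_deriv ?_
    field_simp
  have hpos : ∀ x ∈ Set.Ioi (√k), 0 ≤ x * Real.exp (-c * x ^ 2) := fun x hx =>
    mul_nonneg ((Real.sqrt_nonneg k).trans (le_of_lt hx)) (Real.exp_pos _).le
  have hlim : Filter.Tendsto (fun r : ℝ => -(1 / (2 * c)) * Real.exp (-c * r ^ 2)) Filter.atTop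
      (nhds 0) := by
    have h2 : Filter.Tendsto (fun r : ℝ => -c * r ^ 2) Filter.atTop Filter.atBot :=
      Filter.Tendsto.const_mul_atTop_of_neg (by linarith) (Filter.tendsto_pow_atTop (by norm_num))
    simpa using (Real.tendsto_exp_atBot.comp h2).const_mul (-(1 / (2 * c)))
  have hint := integrableOn_Ioi_deriv_of_nonneg' hg hpos hlim
  have hval := integral_Ioi_of_hasDerivAt_of_nonneg' hg hpos hlim
  have hrad : ∫⁻ r in Set.Ioi (√k), ENNReal.ofReal (r * Real.exp (-c * r ^ 2))
      = ENNReal.ofReal (1 / (2 * c) * Real.exp (-c * k)) := by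
    rw [← ofReal_integral_eq_lintegral_ofReal hint, hval]
    · congr 1
      rw [Real.sq_sqrt hk]; ring
    · exact (ae_restrict_iff' measurableSet_Ioi).2 (Filter.Eventually.of_forall hpos)
  have htarget : polarCoord.target = Set.Ioi (0 : ℝ) ×ˢ Set.Ioo (-Real.pi) Real.pi := rfl
  rw [htarget]
  have hcongr : ∫⁻ p in Set.Ioi (0 : ℝ) ×ˢ Set.Ioo (-Real.pi) Real.pi,
      ENNReal.ofReal p.1 • Set.indicator {b : ℂ | k < ‖b‖ ^ 2}
      (fun b => ENNReal.ofReal (Real.exp (-c * ‖b‖ ^ 2))) (Complex.polarCoord.symm p)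
      = ∫⁻ p in Set.Ioi (0 : ℝ) ×ˢ Set.Ioo (-Real.pi) Real.pi,
        (Set.indicator (Set.Ioi (√k)) (fun r => ENNReal.ofReal (r * Real.exp (-c * r ^ 2))) p.1)
          * 1 := by
    refine setLIntegral_congr_fun (measurableSet_Ioi.prod measurableSet_Ioo) ?_
    rintro ⟨r, θ⟩ ⟨hr, -⟩
    have hr' : 0 < r := hr
    have hn : ‖Complex.polarCoord.symm (r, θ)‖ = r := by
      rw [Complex.norm_polarCoord_symm]; exact abs_of_pos hr'
    have hiff : k < r ^ 2 ↔ √k < r := (Real.sqrt_lt' hr').symm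
    simp only [Set.indicator, Set.mem_ofPred_eq, hn, Set.mem_Ioi, hiff, smul_eq_mul, mul_one]
    split_ifs
    · rw [ENNReal.ofReal_mul hr'.le]
    · simp
  rw [hcongr, Measure.volume_eq_prod, ← Measure.prod_restrict]
  rw [lintegral_prod_mul (f := Set.indicator (Set.Ioi (√k))
    (fun r => ENNReal.ofReal (r * Real.exp (-c * r ^ 2)))) (g := fun _ => 1)]
  · rw [setLIntegral_indicator measurableSet_Ioi]
    have : Set.Ioi (√k) ∩ Set.Ioi (0:ℝ) = Set.Ioi (√k) :=
      Set.inter_eq_left.2 (Set.Ioi_subset_Ioi (Real.sqrt_nonneg k))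
    rw [this, hrad, setLIntegral_const, Real.volume_Ioo, one_mul,
      ← ENNReal.ofReal_mul (by positivity)]
    congr 1
    field_simp
    ring
  · exact (Measurable.indicator (by fun_prop) measurableSet_Ioi).aemeasurable
  · fun_prop

lemma gauss_full (c : ℝ) (hc : 0 < c) :
    ∫⁻ b : ℂ, ENNReal.ofReal (Real.exp (-c * ‖b‖ ^ 2)) = ENNReal.ofReal (Real.pi / c) := by
  have h := gauss_tail c 0 hc le_rfl
  rw [mul_zero, Real.exp_zero, mul_one] at h
  rw [← h]
  refine lintegral_congr_ae ?_
  have : ∀ᵐ b : ℂ, b ≠ 0 := by simp [ae_iff]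
  filter_upwards [this] with b hb
  rw [Set.indicator_of_mem]
  have := norm_pos_iff.2 hb
  simp only [Set.mem_ofPred_eq]; positivity

/-- Gaussian weight. -/
noncomputable def gw (z : ℂ × ℂ) : ENNReal :=
  ENNReal.ofReal (Real.exp (-(‖z.1‖ ^ 2 + ‖z.2‖ ^ 2)))

lemma gw_mul (z : ℂ × ℂ) : gw z = ENNReal.ofReal (Real.exp (-1 * ‖z.1‖ ^ 2)) *
    ENNReal.ofReal (Real.exp (-1 * ‖z.2‖ ^ 2)) := by
  rw [gw, ← ENNReal.ofReal_mul (Real.exp_pos _).le, ← Real.exp_add]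
  congr 2; ring

/-- The cone. -/
def coneE (s : ℝ) : Set (ℂ × ℂ) := {z | ‖z.1‖ ^ 2 < s * (‖z.1‖ ^ 2 + ‖z.2‖ ^ 2)}

lemma coneE_meas (s : ℝ) : MeasurableSet (coneE s) :=
  measurableSet_lt (by fun_prop) (by fun_prop)

lemma gw_meas : Measurable gw := by unfold gw; fun_prop

lemma gw_total : ∫⁻ z, gw z = ENNReal.ofReal (Real.pi ^ 2) := by
  simp_rw [gw_mul]
  rw [Measure.volume_eq_prod, lintegral_prod_mul (f := fun a : ℂ => ENNReal.ofReal
    (Real.exp (-1 * ‖a‖ ^ 2))) (g := fun a : ℂ => ENNReal.ofReal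
    (Real.exp (-1 * ‖a‖ ^ 2))) (by fun_prop) (by fun_prop), gauss_full 1 one_pos,
    ← ENNReal.ofReal_mul (by positivity)]
  congr 1; ring

lemma gw_cone (s : ℝ) (h0 : 0 < s) (h1 : s ≤ 1) :
    ∫⁻ z, (coneE s).indicator gw z = ENNReal.ofReal (Real.pi ^ 2 * s) := by
  rw [Measure.volume_eq_prod, lintegral_prod _ (gw_meas.indicator (coneE_meas s)).aemeasurable]
  have : ∀ a : ℂ, ∫⁻ b : ℂ, (coneE s).indicator gw (a, b)
      = ENNReal.ofReal Real.pi * ENNReal.ofReal (Real.exp (-(1 / s) * ‖a‖ ^ 2)) := by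
    intro a
    have hk : 0 ≤ (1 - s) / s * ‖a‖ ^ 2 :=
      mul_nonneg (div_nonneg (by linarith) h0.le) (by positivity)
    have h := gauss_tail 1 ((1 - s) / s * ‖a‖ ^ 2) one_pos hk
    have h2 : ∀ b : ℂ, (coneE s).indicator gw (a, b) =
        ENNReal.ofReal (Real.exp (-1 * ‖a‖ ^ 2)) *
        Set.indicator {b : ℂ | (1 - s) / s * ‖a‖ ^ 2 < ‖b‖ ^ 2}
          (fun b => ENNReal.ofReal (Real.exp (-1 * ‖b‖ ^ 2))) b := by
      intro b
      have hiff : ‖a‖ ^ 2 < s * (‖a‖ ^ 2 + ‖b‖ ^ 2) ↔ (1 - s) / s * ‖a‖ ^ 2 < ‖b‖ ^ 2 := by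
        rw [div_mul_eq_mul_div, div_lt_iff₀ h0]
        constructor <;> intro h <;> nlinarith
      simp only [Set.indicator, coneE, Set.mem_ofPred_eq, hiff, gw_mul]
      split_ifs <;> simp
    simp_rw [h2]
    rw [lintegral_const_mul' _ _ ENNReal.ofReal_ne_top, h,
      ← ENNReal.ofReal_mul (Real.exp_pos _).le, ← ENNReal.ofReal_mul Real.pi_pos.le]
    congr 1
    rw [div_one, mul_left_comm, ← Real.exp_add]
    congr 2
    field_simp
    ring
  simp_rw [this]
  rw [lintegral_const_mul' _ _ ENNReal.ofReal_ne_top, gauss_full _ (by positivity),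
      ← ENNReal.ofReal_mul Real.pi_pos.le]
  congr 1
  field_simp

/-- The rotation. -/
noncomputable def rotT (p q : ℂ) (z : ℂ × ℂ) : ℂ × ℂ :=
  (z.1 * p + z.2 * q, z.1 * star q - z.2 * star p)

lemma norm_sq_pq {p q : ℂ} (h : ‖p‖ ^ 2 + ‖q‖ ^ 2 = 1) : p * star p + q * star q = 1 := by
  have h1 : p * star p = ((‖p‖ ^ 2 : ℝ) : ℂ) := by
    simpa using Complex.mul_conj' p
  have h2 : q * star q = ((‖q‖ ^ 2 : ℝ) : ℂ) := by
    simpa using Complex.mul_conj' q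
  rw [h1, h2, ← Complex.ofReal_add, h, Complex.ofReal_one]

lemma rotT_norm' (p q : ℂ) (z : ℂ × ℂ) :
    ‖(rotT p q z).1‖ ^ 2 + ‖(rotT p q z).2‖ ^ 2 =
      (‖p‖ ^ 2 + ‖q‖ ^ 2) * (‖z.1‖ ^ 2 + ‖z.2‖ ^ 2) := by
  obtain ⟨a, b⟩ := z
  simp only [rotT, ← Complex.normSq_eq_norm_sq, Complex.normSq_apply]
  simp
  ring

lemma rotT_norm {p q : ℂ} (h : ‖p‖ ^ 2 + ‖q‖ ^ 2 = 1) (z : ℂ × ℂ) :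
    ‖(rotT p q z).1‖ ^ 2 + ‖(rotT p q z).2‖ ^ 2 = ‖z.1‖ ^ 2 + ‖z.2‖ ^ 2 := by
  rw [rotT_norm', h, one_mul]

noncomputable def rotL (p q : ℂ) (h : ‖p‖ ^ 2 + ‖q‖ ^ 2 = 1) :
    WithLp 2 (ℂ × ℂ) ≃ₗᵢ[ℝ] WithLp 2 (ℂ × ℂ) where
  toFun z := WithLp.toLp 2 (rotT p q z.ofLp)
  invFun z := WithLp.toLp 2 (star p * z.fst + q * z.snd, star q * z.fst - p * z.snd)
  map_add' x y := by
    apply WithLp.ofLp_injective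
    ext1 <;> simp [rotT] <;> ring
  map_smul' c x := by
    apply WithLp.ofLp_injective
    ext1 <;> simp [rotT] <;> ring
  left_inv z := by
    have := norm_sq_pq h
    apply WithLp.ofLp_injective
    simp at this
    ext1
    · simp [rotT]
      linear_combination z.fst * this
    · simp [rotT]
      linear_combination z.snd * this
  right_inv z := by
    have := norm_sq_pq h
    apply WithLp.ofLp_injective
    simp at this
    ext1
    · simp [rotT]
      linear_combination z.fst * this
    · simp [rotT]
      linear_combination z.snd * this
  norm_map' z := by
    have h1 : ∀ w : WithLp 2 (ℂ × ℂ), ‖w‖ ^ 2 = ‖w.fst‖ ^ 2 + ‖w.snd‖ ^ 2 :=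
      fun w => WithLp.prod_norm_sq_eq_of_L2 w
    rw [← sq_eq_sq₀ (norm_nonneg _) (norm_nonneg _), h1, h1]
    exact rotT_norm h z.ofLp

lemma rotT_mp (p q : ℂ) (h : ‖p‖ ^ 2 + ‖q‖ ^ 2 = 1) :
    MeasurePreserving (rotT p q) (volume : Measure (ℂ × ℂ)) volume :=
  ((WithLp.volume_preserving_ofLp ℂ ℂ).comp (rotL p q h).measurePreserving).comp
    (WithLp.volume_preserving_toLp ℂ ℂ)

lemma gw_cone_rot (s : ℝ) (p q : ℂ) (h : ‖p‖ ^ 2 + ‖q‖ ^ 2 = 1) :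
    ∫⁻ z, (coneE s).indicator gw (rotT p q z) = ∫⁻ z, (coneE s).indicator gw z :=
  (rotT_mp p q h).lintegral_comp (gw_meas.indicator (coneE_meas s))

lemma col_norm (U : Matrix.unitaryGroup (Fin 2) ℂ) :
    ‖U.val 0 0‖ ^ 2 + ‖U.val 1 0‖ ^ 2 = 1 := by
  have h := congrFun (congrFun (Matrix.UnitaryGroup.star_mul_self U) 0) 0
  simp [Matrix.mul_apply, Fin.sum_univ_two, Complex.conj_mul'] at h
  exact_mod_cast h

/-- Unitary matrix attached to a unit vector. -/
noncomputable def vmat (a b : ℂ) (h : ‖a‖ ^ 2 + ‖b‖ ^ 2 = 1) : Matrix.unitaryGroup (Fin 2) ℂ :=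
  ⟨!![a, b; -star b, star a], by
    have := norm_sq_pq h
    simp at this
    rw [Matrix.mem_unitaryGroup_iff]
    ext i j
    fin_cases i <;> fin_cases j <;> simp [Matrix.mul_apply, Fin.sum_univ_two, star_eq_conjTranspose]
      <;> first | ring1 | linear_combination this⟩

lemma entry_meas (i j : Fin 2) :
    Measurable (fun U : Matrix.unitaryGroup (Fin 2) ℂ => U.val i j) := by
  apply Continuous.measurable
  exact (continuous_apply_apply i j).comp continuous_subtype_val

def colS (s : ℝ) : Set (Matrix.unitaryGroup (Fin 2) ℂ) := {U | (U.val 0 0, U.val 1 0) ∈ coneE s}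

lemma colS_meas (s : ℝ) : MeasurableSet (colS s) :=
  ((entry_meas 0 0).prodMk (entry_meas 1 0)) (coneE_meas s)

lemma vmat_mem (s : ℝ) (z : ℂ × ℂ) (hz : z ≠ 0) : ∃ V : Matrix.unitaryGroup (Fin 2) ℂ,
    ∀ U, V * U ∈ colS s ↔ rotT (U.val 0 0) (U.val 1 0) z ∈ coneE s := by
  obtain ⟨a, b⟩ := z
  have hr : 0 < ‖a‖ ^ 2 + ‖b‖ ^ 2 := by
    by_contra hcon
    have ha : ‖a‖ = 0 := by nlinarith [sq_nonneg ‖a‖, sq_nonneg ‖b‖]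
    have hb : ‖b‖ = 0 := by nlinarith [sq_nonneg ‖a‖, sq_nonneg ‖b‖]
    exact hz (by simp [norm_eq_zero.1 ha, norm_eq_zero.1 hb])
  set r := √(‖a‖ ^ 2 + ‖b‖ ^ 2) with hrdef
  have hr0 : 0 < r := Real.sqrt_pos.2 hr
  have hr2 : r ^ 2 = ‖a‖ ^ 2 + ‖b‖ ^ 2 := Real.sq_sqrt hr.le
  have hu : ‖a / r‖ ^ 2 + ‖b / r‖ ^ 2 = 1 := by
    simp only [norm_div, Complex.norm_real, Real.norm_eq_abs, div_pow, sq_abs]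
    rw [← add_div, hr2, div_self hr.ne']
  refine ⟨vmat (a / r) (b / r) hu, fun U => ?_⟩
  set p := U.val 0 0
  set q := U.val 1 0
  have e0 : (vmat (a / r) (b / r) hu * U).val 0 0 = (a * p + b * q) / r := by
    simp [vmat, Matrix.mul_apply, Fin.sum_univ_two, p, q]
    ring
  have e1 : (vmat (a / r) (b / r) hu * U).val 1 0 = star (a * star q - b * star p) / r := by
    simp [vmat, Matrix.mul_apply, Fin.sum_univ_two, p, q]
    ring
  simp only [colS, coneE, Set.mem_ofPred_eq, e0, e1, rotT, norm_div, norm_star, Complex.norm_real,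
    Real.norm_eq_abs, div_pow, sq_abs]
  rw [← add_div, ← mul_div_assoc, div_lt_div_iff_of_pos_right (by positivity)]

lemma colS_measure (s : ℝ) (h0 : 0 < s) (h1 : s ≤ 1)
    (μ : Measure (Matrix.unitaryGroup (Fin 2) ℂ)) [IsProbabilityMeasure μ]
    [μ.IsMulLeftInvariant] : μ (colS s) = ENNReal.ofReal s := by
  have hpi : 0 < Real.pi ^ 2 := by positivity
  let F : (ℂ × ℂ) → Matrix.unitaryGroup (Fin 2) ℂ → ENNReal := fun z U =>
    (coneE s).indicator gw (rotT (U.val 0 0) (U.val 1 0) z)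
  have hF : Measurable (Function.uncurry F) := by
    refine (gw_meas.indicator (coneE_meas s)).comp ?_
    have m0 : Measurable (fun x : (ℂ × ℂ) × Matrix.unitaryGroup (Fin 2) ℂ => x.2.val 0 0) :=
      (entry_meas 0 0).comp measurable_snd
    have m1 : Measurable (fun x : (ℂ × ℂ) × Matrix.unitaryGroup (Fin 2) ℂ => x.2.val 1 0) :=
      (entry_meas 1 0).comp measurable_snd
    have a0 : Measurable (fun x : (ℂ × ℂ) × Matrix.unitaryGroup (Fin 2) ℂ => x.1.1) := by fun_prop
    have a1 : Measurable (fun x : (ℂ × ℂ) × Matrix.unitaryGroup (Fin 2) ℂ => x.1.2) := by fun_prop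
    have c : Measurable (fun x : ℂ => star x) := continuous_star.measurable
    exact ((a0.mul m0).add (a1.mul m1)).prodMk ((a0.mul (c.comp m1)).sub (a1.mul (c.comp m0)))
  have hswap : ∫⁻ z, ∫⁻ U, F z U ∂μ = ∫⁻ U, (∫⁻ z, F z U) ∂μ :=
    lintegral_lintegral_swap hF.aemeasurable
  have hR : ∫⁻ U, (∫⁻ z, F z U) ∂μ = ENNReal.ofReal (Real.pi ^ 2 * s) := by
    simp only [F, gw_cone_rot s _ _ (col_norm _), gw_cone s h0 h1, lintegral_const, measure_univ,
      mul_one]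
  have hL : ∫⁻ z, ∫⁻ U, F z U ∂μ = ENNReal.ofReal (Real.pi ^ 2) * μ (colS s) := by
    rw [← gw_total, ← lintegral_mul_const _ gw_meas]
    refine lintegral_congr_ae ?_
    have : ∀ᵐ z : ℂ × ℂ, z ≠ 0 := by
      have h00 : ({0} : Set (ℂ × ℂ)) = {0} ×ˢ {0} := by
        rw [Set.singleton_prod_singleton]; rfl
      have hv : volume ({0} : Set (ℂ × ℂ)) = 0 := by
        rw [h00, Measure.volume_eq_prod, Measure.prod_prod]; simp
      simp [ae_iff, hv]
    filter_upwards [this] with z hz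
    obtain ⟨V, hV⟩ := vmat_mem s z hz
    have hFz : ∀ U, F z U = ((fun U => V * U) ⁻¹' colS s).indicator (fun _ => gw z) U := by
      intro U
      have hg : gw (rotT (U.val 0 0) (U.val 1 0) z) = gw z := by
        rw [gw, gw, rotT_norm (col_norm U)]
      have hm : U ∈ (fun U => V * U) ⁻¹' colS s ↔
          rotT (U.val 0 0) (U.val 1 0) z ∈ coneE s := hV U
      by_cases hc : rotT (U.val 0 0) (U.val 1 0) z ∈ coneE s
      · rw [Set.indicator_of_mem (hm.2 hc)]
        exact (Set.indicator_of_mem hc _).trans hg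
      · rw [Set.indicator_of_notMem (fun h => hc (hm.1 h))]
        exact Set.indicator_of_notMem hc _
    simp_rw [hFz]
    rw [lintegral_indicator_const ((measurable_const_mul V) (colS_meas s)), measure_preimage_mul]
  rw [hL, hR, ENNReal.ofReal_mul hpi.le] at hswap
  exact (ENNReal.mul_right_inj (by simpa using Real.pi_pos.ne') ENNReal.ofReal_ne_top).1 hswap

/-- for `μ` the Haar probability measure on `U(2)`,
`0 ≤ ρ₂ < ρ₁` and `R ≥ 0` with `2^{R/2} ≤ 1 + ρ₁`,
`μ{U : 2·log₂(1 + ρ₁|U₁₁|² + ρ₂|U₂₁|²) < R} = max((2^{R/2}−1−ρ₂)/(ρ₁−ρ₂), 0)`. -/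
theorem haar_single_user_outage (ρ₁ ρ₂ R : ℝ) (hρ₂ : 0 ≤ ρ₂) (hρ : ρ₂ < ρ₁)
    (hR : 0 ≤ R) (hRb : (2 : ℝ) ^ (R / 2) ≤ 1 + ρ₁)
    (μ : Measure (Matrix.unitaryGroup (Fin 2) ℂ)) [IsProbabilityMeasure μ]
    [μ.IsMulLeftInvariant] :
    (μ {U : Matrix.unitaryGroup (Fin 2) ℂ |
        2 * Real.logb 2 (1 + ρ₁ * ‖U.val 0 0‖ ^ 2 + ρ₂ * ‖U.val 1 0‖ ^ 2) < R}).toReal =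
      max (((2 : ℝ) ^ (R / 2) - 1 - ρ₂) / (ρ₁ - ρ₂)) 0 := by
  set s := ((2 : ℝ) ^ (R / 2) - 1 - ρ₂) / (ρ₁ - ρ₂) with hs
  have hd : 0 < ρ₁ - ρ₂ := by linarith
  have hs1 : s ≤ 1 := by rw [hs, div_le_one hd]; linarith
  have hset : {U : Matrix.unitaryGroup (Fin 2) ℂ |
        2 * Real.logb 2 (1 + ρ₁ * ‖U.val 0 0‖ ^ 2 + ρ₂ * ‖U.val 1 0‖ ^ 2) < R} = colS s := by
    ext U
    have hU := col_norm U
    have hx : 0 < 1 + ρ₁ * ‖U.val 0 0‖ ^ 2 + ρ₂ * ‖U.val 1 0‖ ^ 2 := by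
      have : 0 ≤ ρ₁ := by linarith
      positivity
    simp only [colS, coneE, Set.mem_ofPred_eq, hU, mul_one]
    rw [hs, lt_div_iff₀ hd, ← lt_div_iff₀' (by norm_num : (0:ℝ) < 2),
      Real.logb_lt_iff_lt_rpow (by norm_num) hx]
    have hU' : ‖U.val 1 0‖ ^ 2 = 1 - ‖U.val 0 0‖ ^ 2 := by linarith
    rw [hU']
    constructor <;> intro h <;> nlinarith
  rw [hset]
  rcases lt_or_ge 0 s with h0 | h0
  · rw [colS_measure s h0 hs1, ENNReal.toReal_ofReal h0.le, max_eq_left h0.le]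
  · have : colS s = ∅ := by
      ext U
      simp only [colS, coneE, Set.mem_ofPred_eq, col_norm U, mul_one, Set.mem_empty_iff_false,
        iff_false, not_lt]
      exact h0.trans (by positivity)
    rw [this, max_eq_right h0]; simp
end
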